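/- arXiv:2502.09807 — 3 statements merged into one kernel-verified Lean document; each statement's English description precedes it below -/
import Mathlib

section
/- Let (x_i)_{i≥1} be points of [0,1]^n, (r_i)_{i≥1} positive reals with r_i → 0, and a = (a_1,…,a_n) ∈ ℝ_{>0}^n. Suppose that the limsup of the rectangles R(x_i, r_i^a) = ∏_{j=1}^n B(x_i^{(j)}, r_i^{a_j}) has full n-dimensional Lebesgue measure in [0,1]^n. Let (γ_i)_{i≥1}, γ_i = (γ_i^{(1)},…,γ_i^{(n)}) ∈ ℝ^n, be such that x_i + γ_i ∈ [0,1]^n for all i and limsup_{i→∞} |γ_i^{(j)}| · r_i^{-a_j} < ∞ for each j = 1,…,n. Then for every t = (t_1,…,t_n) ∈ ℝ_{≥0}^n, the Hausdorff dimension of limsup_{i→∞} ∏_{j=1}^n B(x_i^{(j)} + γ_i^{(j)}, r_i^{a_j + t_j}) is at least min_{A ∈ {a_1+t_1, …, a_n+t_n}} ( #K₁ + #K₂ + ( Σ_{j∈K₃} a_j − Σ_{j∈K₂} t_j ) / A ), where for each A the partition of {1,…,n} is K₁ = {j : a_j ≥ A}, K₂ = {j : a_j + t_j ≤ A} \ K₁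 and K₃ = {1,…,n} \ (K₁ ∪ K₂). -/
open MeasureTheory Filter Set

/-- The unit cube `[0,1]^n` in `ℝ^n`. -/
def unitCube (n : ℕ) : Set (Fin n → ℝ) := Set.univ.pi fun _ => Set.Icc (0 : ℝ) 1

open scoped Classical in
/-- The lower bound
`min_{A ∈ {a_1+t_1,…,a_n+t_n}} ( #K₁ + #K₂ + (Σ_{j∈K₃} a_j − Σ_{j∈K₂} t_j)/A )`,
where `K₁ = {j : a_j ≥ A}`, `K₂ = {j : a_j + t_j ≤ A} \ K₁` and `K₃` is the rest. -/
noncomputable def mtprrBound (n : ℕ) (a t : Fin n → ℝ) : ℝ :=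
  ⨅ k : Fin n,
    (fun A : ℝ =>
      (fun K₁ K₂ : Finset (Fin n) =>
        (K₁.card : ℝ) + (K₂.card : ℝ) +
          ((∑ j ∈ Finset.univ \ (K₁ ∪ K₂), a j) - ∑ j ∈ K₂, t j) / A)
      (Finset.univ.filter fun j => A ≤ a j)
      ((Finset.univ.filter fun j => a j + t j ≤ A) \
        (Finset.univ.filter fun j => A ≤ a j)))
    (a k + t k)

open scoped ENNReal NNReal

/-- The exponent contributed by one coordinate, multiplied by `A`. -/
noncomputable def coordExponent (a t A : ℝ) : ℝ := min A a + max 0 (A - (a + t))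

theorem coordExponent_le {a t A : ℝ} (ht : 0 ≤ t) : coordExponent a t A ≤ A := by
  unfold coordExponent
  rcases le_total A (a + t) with h | h
  · rw [max_eq_left (by linarith)]; linarith [min_le_left A a]
  · rw [max_eq_right (by linarith)]; linarith [min_le_right A a]

theorem coordExponent_nonneg {a t A : ℝ} (ha : 0 ≤ a) (hA : 0 ≤ A) : 0 ≤ coordExponent a t A :=
  add_nonneg (le_min hA ha) (le_max_left _ _)

theorem coordExponent_mul {a t A v : ℝ} (hv : 0 ≤ v) :
    coordExponent (a * v) (t * v) (A * v) = coordExponent a t A * v := by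
  unfold coordExponent
  rw [add_mul, min_mul_of_nonneg _ _ hv, max_mul_of_nonneg _ _ hv]
  congr 2 <;> ring

theorem concaveOn_coordExponent_Iic (a t : ℝ) :
    ConcaveOn ℝ (Iic (a + t)) (coordExponent a t) := by
  have h : ConcaveOn ℝ (Iic (a + t)) fun A : ℝ => min A a :=
    (concaveOn_id (convex_Iic _)).inf (concaveOn_const _ (convex_Iic _))
  refine h.congr fun A hA => ?_
  rw [coordExponent, max_eq_left (by linarith [mem_Iic.1 hA]), add_zero]

theorem concaveOn_coordExponent_Ici {a t : ℝ} (ht : 0 ≤ t) :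
    ConcaveOn ℝ (Ici (a + t)) (coordExponent a t) := by
  have h : ConcaveOn ℝ (Ici (a + t)) fun A : ℝ => A + (-t) :=
    (concaveOn_id (convex_Ici _)).add (concaveOn_const _ (convex_Ici _))
  refine h.congr fun A hA => ?_
  have := mem_Ici.1 hA
  rw [coordExponent, max_eq_right (by linarith), min_eq_right (by linarith)]
  ring

theorem bound_term_eq {n : ℕ} (a t : Fin n → ℝ) (ht : ∀ j, 0 ≤ t j) {A : ℝ} (hA : 0 < A)
    (K₁ K₂ : Finset (Fin n)) (h₁ : ∀ j, j ∈ K₁ ↔ A ≤ a j)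
    (h₂ : ∀ j, j ∈ K₂ ↔ a j + t j ≤ A ∧ ¬ A ≤ a j) :
    (K₁.card : ℝ) + (K₂.card : ℝ) +
      ((∑ j ∈ Finset.univ \ (K₁ ∪ K₂), a j) - ∑ j ∈ K₂, t j) / A =
      (∑ j, coordExponent (a j) (t j) A) / A := by
  have hd : Disjoint K₁ K₂ := by
    rw [Finset.disjoint_left]; intro j hj hj'; exact ((h₂ j).1 hj').2 ((h₁ j).1 hj)
  have hs : ∑ j, coordExponent (a j) (t j) A =
      (∑ j ∈ Finset.univ \ (K₁ ∪ K₂), a j) + (∑ j ∈ K₁, A + ∑ j ∈ K₂, (A - t j)) := by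
    rw [← Finset.sum_sdiff (Finset.subset_univ (K₁ ∪ K₂)), Finset.sum_union hd]
    congr 1
    · refine Finset.sum_congr rfl fun j hj => ?_
      simp only [Finset.mem_sdiff, Finset.mem_univ, Finset.mem_union, h₁, h₂, true_and,
        not_or, not_and, not_le] at hj
      have : A < a j + t j := by
        by_contra! h
        exact hj.2 h hj.1
      rw [coordExponent, min_eq_right hj.1.le, max_eq_left (by linarith), add_zero]
    · congr 1
      · refine Finset.sum_congr rfl fun j hj => ?_
        rw [h₁] at hj
        rw [coordExponent, min_eq_left hj, max_eq_left (by linarith [ht j]), add_zero]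
      · refine Finset.sum_congr rfl fun j hj => ?_
        rw [h₂, not_le] at hj
        rw [coordExponent, min_eq_right hj.2.le, max_eq_right (by linarith)]
        ring
  rw [hs, Finset.sum_sub_distrib]
  simp only [Finset.sum_const, nsmul_eq_mul]
  field_simp
  ring

theorem mtprrBound_eq {n : ℕ} (a t : Fin n → ℝ) (ha : ∀ j, 0 < a j) (ht : ∀ j, 0 ≤ t j) :
    mtprrBound n a t =
      ⨅ k, (∑ j, coordExponent (a j) (t j) (a k + t k)) / (a k + t k) := by
  unfold mtprrBound
  refine iInf_congr fun k => ?_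
  exact bound_term_eq a t ht (add_pos_of_pos_of_nonneg (ha k) (ht k)) _ _
    (fun j => by simp) (fun j => by simp)

theorem mtprrBound_mul_le_of_mem {n : ℕ} (a t : Fin n → ℝ) (ha : ∀ j, 0 < a j)
    (ht : ∀ j, 0 ≤ t j) (k : Fin n) :
    mtprrBound n a t * (a k + t k) ≤ ∑ j, coordExponent (a j) (t j) (a k + t k) := by
  rw [mtprrBound_eq a t ha ht, ← le_div_iff₀ (add_pos_of_pos_of_nonneg (ha k) (ht k))]
  exact ciInf_le (Set.finite_range _).bddBelow k

theorem mtprrBound_le {n : ℕ} (hn : 0 < n) (a t : Fin n → ℝ) (ha : ∀ j, 0 < a j)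
    (ht : ∀ j, 0 ≤ t j) : mtprrBound n a t ≤ n := by
  have hk := add_pos_of_pos_of_nonneg (ha ⟨0, hn⟩) (ht ⟨0, hn⟩)
  refine le_of_mul_le_mul_right ((mtprrBound_mul_le_of_mem a t ha ht ⟨0, hn⟩).trans ?_) hk
  refine (Finset.sum_le_sum fun j _ => coordExponent_le (ht j)).trans ?_
  simp [mul_add]

/-- The minimum defining `mtprrBound` may be taken over all `A ≥ 0`. -/
theorem mtprrBound_mul_le {n : ℕ} (hn : 0 < n) (a t : Fin n → ℝ) (ha : ∀ j, 0 < a j)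
    (ht : ∀ j, 0 ≤ t j) {A : ℝ} (hA : 0 ≤ A) :
    mtprrBound n a t * A ≤ ∑ j, coordExponent (a j) (t j) A := by
  set s := mtprrBound n a t with hs
  set g : ℝ → ℝ := fun A => ∑ j, coordExponent (a j) (t j) A with hg
  have hb : ∀ k, s * (a k + t k) ≤ g (a k + t k) := mtprrBound_mul_le_of_mem a t ha ht
  have hbpos : ∀ k, 0 < a k + t k := fun k => add_pos_of_pos_of_nonneg (ha k) (ht k)
  have hlow : ∃ l, 0 ≤ l ∧ l ≤ A ∧ s * l ≤ g l ∧ ∀ j, a j + t j ≤ A → a j + t j ≤ l := by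
    let S := Finset.univ.filter fun j => a j + t j ≤ A
    rcases S.eq_empty_or_nonempty with h | h
    · refine ⟨0, le_rfl, hA, ?_, fun j hj => ?_⟩
      · rw [mul_zero]
        exact Finset.sum_nonneg fun j _ => coordExponent_nonneg (ha j).le le_rfl
      · have : j ∈ S := by simp [S, hj]
        simp [h] at this
    · obtain ⟨k, hk, hmax⟩ := S.exists_max_image (fun j => a j + t j) h
      exact ⟨a k + t k, (hbpos k).le, by simpa [S] using hk, hb k,
        fun j hj => hmax j (by simp [S, hj])⟩
  obtain ⟨l, hl0, hlA, hgl, hlmax⟩ := hlow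
  let T := Finset.univ.filter fun j => A < a j + t j
  rcases T.eq_empty_or_nonempty with h | h
  · have hall : ∀ j, a j + t j ≤ A := fun j => by
      by_contra! hj
      have : j ∈ T := by simp [T, hj]
      simp [h] at this
    have key : g A = g l + n * (A - l) := by
      have : ∀ j, coordExponent (a j) (t j) A = coordExponent (a j) (t j) l + (A - l) := by
        intro j
        have h1 := hall j
        have h2 := hlmax j h1
        have h3 := ht j
        simp only [coordExponent]
        rw [min_eq_right (by linarith), min_eq_right (by linarith), max_eq_right (by linarith),
          max_eq_right (by linarith)]
        ring
      simp [hg, this, Finset.sum_add_distrib, mul_sub]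
    have := mtprrBound_le hn a t ha ht
    change s * A ≤ g A
    nlinarith [mul_le_mul_of_nonneg_right this (sub_nonneg.2 hlA)]
  · obtain ⟨k, hk, hmin⟩ := T.exists_min_image (fun j => a j + t j) h
    have hAk : A < a k + t k := by simpa [T] using hk
    have hc : ConcaveOn ℝ (Icc l (a k + t k)) g := by
      have : ∀ j ∈ Finset.univ, ConcaveOn ℝ (Icc l (a k + t k)) (coordExponent (a j) (t j)) := by
        intro j _
        rcases le_or_gt (a j + t j) A with hj | hj
        · exact (concaveOn_coordExponent_Ici (ht j)).subset
            (fun y hy => (hlmax j hj).trans hy.1) (convex_Icc _ _)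
        · exact (concaveOn_coordExponent_Iic _ _).subset
            (fun y hy => hy.2.trans (hmin j (by simp [T, hj]))) (convex_Icc _ _)
      have h2 : ∀ S : Finset (Fin n), ConcaveOn ℝ (Icc l (a k + t k))
          (fun A => ∑ j ∈ S, coordExponent (a j) (t j) A) := by
        classical
        intro S
        induction S using Finset.induction_on with
        | empty => simpa using concaveOn_const 0 (convex_Icc _ _)
        | insert j S hj ih =>
          simp only [Finset.sum_insert hj]
          exact (this j (Finset.mem_univ j)).add ih
      exact h2 _
    have hc' := hc.add (f := g) (g := fun y => (-s) * y)
      ((LinearMap.mulLeft ℝ (-s)).concaveOn (convex_Icc _ _))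
    have := hc'.ge_on_segment (left_mem_Icc.2 (hlA.trans hAk.le))
      (right_mem_Icc.2 (hlA.trans hAk.le)) (z := A)
      (by rw [segment_eq_Icc (hlA.trans hAk.le)]; exact ⟨hlA, hAk.le⟩)
    have h0 : 0 ≤ min ((g + fun y => (-s) * y) l) ((g + fun y => (-s) * y) (a k + t k)) := by
      refine le_min ?_ ?_
      · simp only [Pi.add_apply]; linarith
      · simp only [Pi.add_apply]; linarith [hb k]
    have h1 := h0.trans this
    simp only [Pi.add_apply] at h1
    change s * A ≤ g A
    linarith

/-- The bound on the mass of a cube of side `ρ` in terms of rectangles at scale `σ`. -/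
theorem prod_max_mul_min_le {n : ℕ} (hn : 0 < n) (a t : Fin n → ℝ) (ha : ∀ j, 0 < a j)
    (ht : ∀ j, 0 ≤ t j) {ρ σ : ℝ} (hρ : 0 < ρ) (hρ1 : ρ ≤ 1) (hσ : 0 < σ) (hσ1 : σ ≤ 1) :
    ∏ j, (max ρ (σ ^ a j) * min 1 (ρ / σ ^ (a j + t j))) ≤ ρ ^ mtprrBound n a t := by
  obtain ⟨u, rfl⟩ : ∃ u, ρ = Real.exp (-u) := ⟨-Real.log ρ, by simp [Real.exp_log hρ]⟩
  obtain ⟨v, rfl⟩ : ∃ v, σ = Real.exp (-v) := ⟨-Real.log σ, by simp [Real.exp_log hσ]⟩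
  have hu : 0 ≤ u := by simpa using hρ1
  have hv : 0 ≤ v := by simpa using hσ1
  have key : mtprrBound n a t * u ≤ ∑ j, coordExponent (a j * v) (t j * v) u := by
    rcases hv.eq_or_lt with h | h
    · have : ∀ j, coordExponent (a j * v) (t j * v) u = u := fun j => by
        simp [coordExponent, ← h, hu]
      simp only [this, Finset.sum_const, Finset.card_univ, Fintype.card_fin, nsmul_eq_mul]
      exact mul_le_mul_of_nonneg_right (mtprrBound_le hn a t ha ht) hu
    · have := mul_le_mul_of_nonneg_right
        (mtprrBound_mul_le hn a t ha ht (div_nonneg hu hv)) hv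
      rw [Finset.sum_mul] at this
      simp only [← coordExponent_mul hv] at this
      rwa [mul_assoc, div_mul_cancel₀ _ h.ne'] at this
  have hf : ∀ j, max (Real.exp (-u)) (Real.exp (-v) ^ a j) *
      min 1 (Real.exp (-u) / Real.exp (-v) ^ (a j + t j)) =
      Real.exp (-coordExponent (a j * v) (t j * v) u) := by
    intro j
    rw [← Real.exp_mul, ← Real.exp_mul, ← Real.exp_sub, ← Real.exp_monotone.map_max,
      ← Real.exp_zero, ← Real.exp_monotone.map_min, ← Real.exp_add, coordExponent]
    congr 1
    rw [neg_add, ← max_neg_neg, ← min_neg_neg]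
    congr 2 <;> ring
  rw [Finset.prod_congr rfl fun j _ => hf j, ← Real.exp_sum, ← Real.exp_mul, Finset.sum_neg_distrib]
  apply Real.exp_le_exp.2
  linarith

/-- The closed box with centre `c` and half side lengths `w`. -/
def closedBox {n : ℕ} (c w : Fin n → ℝ) : Set (Fin n → ℝ) :=
  Set.univ.pi fun j => Metric.closedBall (c j) (w j)

/-- The open box with centre `c` and half side lengths `w`. -/
def openBox {n : ℕ} (c w : Fin n → ℝ) : Set (Fin n → ℝ) :=
  Set.univ.pi fun j => Metric.ball (c j) (w j)

section Boxes

variable {n : ℕ}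

theorem mem_closedBox {c w y : Fin n → ℝ} : y ∈ closedBox c w ↔ ∀ j, |y j - c j| ≤ w j := by
  simp [closedBox, Set.mem_pi, Real.dist_eq]

theorem openBox_subset_closedBox (c w : Fin n → ℝ) : openBox c w ⊆ closedBox c w :=
  Set.pi_mono fun _ _ => Metric.ball_subset_closedBall

theorem isOpen_openBox (c w : Fin n → ℝ) : IsOpen (openBox c w) :=
  isOpen_set_pi Set.finite_univ fun _ _ => Metric.isOpen_ball

theorem isCompact_closedBox (c w : Fin n → ℝ) : IsCompact (closedBox c w) :=
  isCompact_univ_pi fun _ => isCompact_closedBall _ _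

theorem measurableSet_closedBox (c w : Fin n → ℝ) : MeasurableSet (closedBox c w) :=
  (isCompact_closedBox c w).measurableSet

theorem volume_closedBox (c w : Fin n → ℝ) :
    volume (closedBox c w) = ∏ j, ENNReal.ofReal (2 * w j) := by
  simp [closedBox, volume_pi_pi, Real.volume_closedBall]

theorem volume_openBox (c w : Fin n → ℝ) :
    volume (openBox c w) = ∏ j, ENNReal.ofReal (2 * w j) := by
  simp [openBox, volume_pi_pi, Real.volume_ball]

theorem volume_openBox_ne_zero {c w : Fin n → ℝ} (hw : ∀ j, 0 < w j) :
    volume (openBox c w) ≠ 0 := by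
  rw [volume_openBox]
  exact Finset.prod_ne_zero_iff.2 fun j _ => by simp [hw j]

theorem volume_openBox_ne_top (c w : Fin n → ℝ) : volume (openBox c w) ≠ ∞ := by
  rw [volume_openBox]
  exact ENNReal.prod_ne_top fun j _ => ENNReal.ofReal_ne_top

theorem volume_closedBox_smul (c w : Fin n → ℝ) {L : ℝ} (hL : 0 ≤ L) :
    volume (closedBox c (L • w)) = ENNReal.ofReal L ^ n * volume (closedBox c w) := by
  simp only [volume_closedBox, Pi.smul_apply, smul_eq_mul, mul_left_comm 2 L,
    ENNReal.ofReal_mul hL, Finset.prod_mul_distrib]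
  simp

/-- A box meeting a box of comparable scale is contained in an enlargement of the latter. -/
theorem closedBox_subset_of_inter_nonempty {a x y : Fin n → ℝ} (ha : ∀ j, 0 < a j)
    {C σ τ : ℝ} (hC : 0 ≤ C) (hσ : 0 < σ) (hτ : 0 < τ) (hle : σ ≤ 2 * τ)
    (hne : (closedBox x (fun j => C * σ ^ a j) ∩
      closedBox y (fun j => C * τ ^ a j)).Nonempty) :
    closedBox x (fun j => C * σ ^ a j) ⊆
      closedBox y ((1 + 2 * 2 ^ ∑ j, a j : ℝ) • fun j => C * τ ^ a j) := by
  obtain ⟨z, hzx, hzy⟩ := hne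
  intro p hp
  rw [mem_closedBox] at *
  intro j
  have h1 : σ ^ a j ≤ 2 ^ (∑ j, a j) * τ ^ a j := by
    calc σ ^ a j ≤ (2 * τ) ^ a j := Real.rpow_le_rpow hσ.le hle (ha j).le
      _ = 2 ^ a j * τ ^ a j := Real.mul_rpow (by norm_num) hτ.le
      _ ≤ _ := by
        gcongr
        · norm_num
        · exact Finset.single_le_sum (fun i _ => (ha i).le) (Finset.mem_univ j)
  have h2 := mul_le_mul_of_nonneg_left h1 hC
  have h3 : |p j - y j| ≤ |p j - x j| + |z j - x j| + |z j - y j| := by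
    rw [show p j - y j = (p j - x j) - (z j - x j) + (z j - y j) by ring]
    exact (abs_add_le _ _).trans (add_le_add_left (abs_sub _ _) _)
  have := hp j
  have := hzx j
  have := hzy j
  simp only [Pi.smul_apply, smul_eq_mul]
  linarith

/-- Vitali covering by finitely many disjoint anisotropic boxes, up to a small error. -/
theorem exists_finset_disjoint_closedBox {a : Fin n → ℝ} (ha : ∀ j, 0 < a j)
    (x : ℕ → Fin n → ℝ) {σ : ℕ → ℝ} (hσ : ∀ i, 0 < σ i) (hσ1 : ∀ i, σ i ≤ 1)
    (hσ0 : Tendsto σ atTop (nhds 0)) {C : ℝ} (hC : 0 < C) {U : Set (Fin n → ℝ)}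
    (hU : IsOpen U) (hUfin : volume U ≠ ∞)
    (hcov : volume (U \ limsup (fun i => closedBox (x i) fun j => C * σ i ^ a j) atTop) = 0)
    (N : ℕ) {η : ℝ≥0∞} (hη : η ≠ 0) :
    ∃ F : Finset ℕ, (∀ i ∈ F, N ≤ i ∧ closedBox (x i) (fun j => C * σ i ^ a j) ⊆ U) ∧
      (F : Set ℕ).PairwiseDisjoint (fun i => closedBox (x i) fun j => C * σ i ^ a j) ∧
      volume (U \ ⋃ i ∈ F, closedBox (x i) fun j => C * σ i ^ a j) ≤ η := by
  classical
  set P : ℕ → Set (Fin n → ℝ) := fun i => closedBox (x i) fun j => C * σ i ^ a j with hP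
  have hPne : ∀ i, (P i).Nonempty := fun i =>
    ⟨x i, mem_closedBox.2 fun j => by
      simpa using mul_nonneg hC.le (Real.rpow_nonneg (hσ i).le _)⟩
  have hPm : ∀ i, MeasurableSet (P i) := fun i => measurableSet_closedBox _ _
  obtain ⟨u, hut, hud, hu⟩ := Vitali.exists_disjoint_subfamily_covering_enlargement P
    {i | N ≤ i ∧ P i ⊆ U} σ 2 one_lt_two (fun i _ => (hσ i).le) 1 (fun i _ => hσ1 i)
    (fun i _ => hPne i)
  set L : ℝ := 1 + 2 * 2 ^ ∑ j, a j with hL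
  have hL0 : 0 ≤ L := by positivity
  set f : ℕ → ℝ≥0∞ := fun i => if i ∈ u then volume (P i) else 0 with hf
  have hsum : ∑' i, f i ≠ ∞ := by
    refine ne_top_of_le_ne_top hUfin ?_
    have h1 : ∀ i, f i = volume (if i ∈ u then P i else ∅) := fun i => by
      by_cases h : i ∈ u <;> simp [hf, h]
    simp only [h1]
    rw [← measure_iUnion]
    · refine measure_mono (iUnion_subset fun i => ?_)
      split_ifs with h
      · exact (hut h).2
      · exact empty_subset _
    · intro i j hij
      simp only [Function.onFun]
      split_ifs with h h'
      · exact hud h h' hij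
      all_goals simp
    · intro i
      split_ifs
      · exact hPm i
      · exact MeasurableSet.empty
  have htail := ENNReal.tendsto_tsum_compl_atTop_zero hsum
  have hη' : 0 < η / ENNReal.ofReal L ^ n :=
    ENNReal.div_pos hη (ENNReal.pow_ne_top ENNReal.ofReal_ne_top)
  obtain ⟨s, hs⟩ := (htail.eventually (gt_mem_nhds hη')).exists
  refine ⟨s.filter (· ∈ u), fun i hi => hut (Finset.mem_filter.1 hi).2, fun i hi j hj hij =>
    hud (Finset.mem_filter.1 hi).2 (Finset.mem_filter.1 hj).2 hij, ?_⟩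
  set V := U \ ⋃ i ∈ s.filter (· ∈ u), P i with hV
  have hVo : IsOpen V := hU.sdiff <|
    isClosed_biUnion_finset fun i _ => (isCompact_closedBox _ _).isClosed
  have hsub : V ⊆ (U \ limsup P atTop) ∪ ⋃ b : {b // b ∉ s},
      if (b : ℕ) ∈ u then closedBox (x b) (L • fun j => C * σ b ^ a j) else ∅ := by
    intro y hy
    by_cases hyl : y ∈ limsup P atTop
    swap
    · exact Or.inl ⟨hy.1, hyl⟩
    right
    obtain ⟨ε, hε, hball⟩ := Metric.isOpen_iff.1 hVo y hy
    have hsmall : ∀ᶠ i in atTop, ∀ j, 2 * (C * σ i ^ a j) < ε := by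
      refine eventually_all.2 fun j => ?_
      have : Tendsto (fun i => 2 * (C * σ i ^ a j)) atTop (nhds (2 * (C * 0 ^ a j))) :=
        ((hσ0.rpow_const (Or.inr (ha j).le)).const_mul C).const_mul 2
      rw [Real.zero_rpow (ha j).ne', mul_zero, mul_zero] at this
      exact this.eventually (gt_mem_nhds hε)
    rw [mem_limsup_iff_frequently_mem] at hyl
    obtain ⟨i, hyi, hi, hNi⟩ := (hyl.and_eventually (hsmall.and (eventually_ge_atTop N))).exists
    have hPV : P i ⊆ V := by
      intro z hz
      refine hball ?_
      rw [Metric.mem_ball, dist_pi_lt_iff hε]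
      intro j
      have h1 := mem_closedBox.1 hz j
      have h2 := mem_closedBox.1 hyi j
      have h3 := hi j
      rw [Real.dist_eq, show z j - y j = (z j - x i j) - (y j - x i j) by ring]
      exact (abs_sub _ _).trans_lt (by linarith)
    obtain ⟨b, hbu, hne, hle⟩ := hu i ⟨hNi, hPV.trans sdiff_subset⟩
    have hbs : b ∉ s := fun hbs => by
      obtain ⟨z, hzi, hzb⟩ := hne
      exact (hPV hzi).2 (mem_biUnion (Finset.mem_coe.2 (Finset.mem_filter.2 ⟨hbs, hbu⟩)) hzb)
    refine mem_iUnion.2 ⟨⟨b, hbs⟩, ?_⟩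
    rw [if_pos hbu]
    exact closedBox_subset_of_inter_nonempty ha hC.le (hσ i) (hσ b) hle hne hyi
  calc volume V ≤ volume (U \ limsup P atTop) + ∑' b : {b // b ∉ s},
      volume (if (b : ℕ) ∈ u then closedBox (x b) (L • fun j => C * σ b ^ a j) else ∅) :=
        (measure_mono hsub).trans
          ((measure_union_le _ _).trans (add_le_add_right (measure_iUnion_le _) _))
    _ = ∑' b : {b // b ∉ s}, ENNReal.ofReal L ^ n * f b := by
      rw [hcov, zero_add]
      refine tsum_congr fun b => ?_
      by_cases h : (b : ℕ) ∈ u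
      · simp only [if_pos h, hf, hP, volume_closedBox_smul _ _ hL0]
      · simp [if_neg h, hf]
    _ = ENNReal.ofReal L ^ n * ∑' b : {b // b ∉ s}, f b := ENNReal.tsum_mul_left
    _ ≤ η := (mul_le_mul_right hs.le _).trans ENNReal.mul_div_le

end Boxes

/-- A mass distribution principle for nested compact sets: a uniform Frostman bound on measures
carried by the approximating sets bounds the dimension of the intersection from below. -/
theorem le_dimH_iInter_of_measure_closedBall_le {X : Type*} [MetricSpace X] [MeasurableSpace X]
    [BorelSpace X] {K : ℕ → Set X} (hK : ∀ k, IsCompact (K k)) (hanti : Antitone K)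
    (ν : ℕ → Measure X) (hν : ∀ k, ν k (K k)ᶜ = 0) {m : ℝ≥0∞} (hm : m ≠ 0)
    (hmass : ∀ k, m ≤ ν k univ) {s D : ℝ≥0}
    (hball : ∀ k y (ρ : ℝ), 0 < ρ → ν k (Metric.closedBall y ρ) ≤ D * ENNReal.ofReal ρ ^ (s : ℝ)) :
    (s : ℝ≥0∞) ≤ dimH (⋂ k, K k) := by
  classical
  apply le_dimH_of_hausdorffMeasure_ne_zero
  intro h0
  obtain ⟨δ, hδ, hδm⟩ : ∃ δ : ℝ≥0∞, δ ≠ 0 ∧ D * (δ + δ) < m := by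
    have : Tendsto (fun δ : ℝ≥0∞ => D * (δ + δ)) (nhds 0) (nhds (D * (0 + 0))) :=
      ENNReal.Tendsto.const_mul (tendsto_id.add tendsto_id) (Or.inr ENNReal.coe_ne_top)
    simp only [add_zero, mul_zero] at this
    have h2 : Tendsto (fun δ : ℝ≥0∞ => D * (δ + δ)) (nhdsWithin 0 {0}ᶜ) (nhds 0) :=
      this.mono_left nhdsWithin_le_nhds
    have := (h2.eventually (gt_mem_nhds (pos_iff_ne_zero.2 hm))).and self_mem_nhdsWithin
    obtain ⟨δ, h1, h2⟩ := this.exists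
    exact ⟨δ, h2, h1⟩
  have hlt : ⨅ (t : ℕ → Set X) (_ : (⋂ k, K k) ⊆ ⋃ n, t n) (_ : ∀ n, Metric.ediam (t n) ≤ 1),
      ∑' n, ⨆ _ : (t n).Nonempty, Metric.ediam (t n) ^ (s : ℝ) < δ := by
    rw [Measure.hausdorffMeasure_apply] at h0
    refine lt_of_le_of_lt ?_ (pos_iff_ne_zero.2 hδ)
    rw [← h0]
    exact le_iSup₂_of_le (1 : ℝ≥0∞) one_pos le_rfl
  simp only [iInf_lt_iff] at hlt
  obtain ⟨t, htK, htd, htsum⟩ := hlt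
  obtain ⟨e, he, hesum⟩ := ENNReal.exists_pos_sum_of_countable hδ ℕ
  have hrad : ∀ n, (t n).Nonempty → ∃ ρ : ℝ, 0 < ρ ∧ Metric.ediam (t n) < ENNReal.ofReal ρ ∧
      ENNReal.ofReal ρ ^ (s : ℝ) ≤ Metric.ediam (t n) ^ (s : ℝ) + e n := by
    intro n _
    have hfin : Metric.ediam (t n) ≠ ∞ := ne_top_of_le_ne_top ENNReal.one_ne_top (htd n)
    have hcont : Tendsto (fun ρ : ℝ≥0∞ => ρ ^ (s : ℝ))
        (nhdsWithin (Metric.ediam (t n)) (Ioi (Metric.ediam (t n))))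
        (nhds (Metric.ediam (t n) ^ (s : ℝ))) :=
      (ENNReal.continuous_rpow_const.tendsto _).mono_left nhdsWithin_le_nhds
    have hlt : Metric.ediam (t n) ^ (s : ℝ) < Metric.ediam (t n) ^ (s : ℝ) + e n :=
      ENNReal.lt_add_right (ENNReal.rpow_ne_top_of_nonneg s.2 hfin)
        (by simpa using (he n).ne')
    have : (nhdsWithin (Metric.ediam (t n)) (Ioi (Metric.ediam (t n)))).NeBot :=
      nhdsGT_neBot_of_exists_gt ⟨∞, hfin.lt_top⟩
    obtain ⟨ρ, hρ1, hρ2, hρ3⟩ := ((hcont.eventually (gt_mem_nhds hlt)).and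
      (eventually_mem_nhdsWithin.and (eventually_nhdsWithin_of_eventually_nhds
        (gt_mem_nhds hfin.lt_top)))).exists
    have hρ3 : ρ ≠ ∞ := ne_of_lt hρ3
    have hρ2 : Metric.ediam (t n) < ρ := hρ2
    refine ⟨ρ.toReal, ENNReal.toReal_pos (pos_of_gt hρ2).ne' hρ3, ?_, ?_⟩
    · rwa [ENNReal.ofReal_toReal hρ3]
    · rw [ENNReal.ofReal_toReal hρ3]; exact hρ1.le
  choose! ρ hρ0 hρd hρs using hrad
  let y : ∀ n, (t n).Nonempty → X := fun n h => h.choose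
  let V : ℕ → Set X := fun n => if h : (t n).Nonempty then Metric.ball (y n h) (ρ n) else ∅
  have htV : ∀ n, t n ⊆ V n := by
    intro n z hz
    have h : (t n).Nonempty := ⟨z, hz⟩
    simp only [V, dif_pos h]
    rw [Metric.mem_ball, ← ENNReal.ofReal_lt_ofReal_iff (hρ0 n h), ← edist_dist]
    exact (Metric.edist_le_ediam_of_mem hz h.choose_spec).trans_lt (hρd n h)
  have hVo : ∀ n, IsOpen (V n) := by
    intro n
    by_cases h : (t n).Nonempty
    · simp only [V, dif_pos h]; exact Metric.isOpen_ball
    · simp only [V, dif_neg h]; exact isOpen_empty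
  obtain ⟨k, hk⟩ := exists_subset_nhds_of_isCompact (hanti.directed_ge) hK
    (U := ⋃ n, V n) fun x hx =>
      (isOpen_iUnion hVo).mem_nhds (iUnion_mono htV (htK hx))
  have hVn : ∀ n, ν k (V n) ≤
      D * ((⨆ _ : (t n).Nonempty, Metric.ediam (t n) ^ (s : ℝ)) + e n) := by
    intro n
    by_cases h : (t n).Nonempty
    · simp only [V, dif_pos h, ciSup_pos h]
      exact (measure_mono Metric.ball_subset_closedBall).trans
        ((hball k _ _ (hρ0 n h)).trans (mul_le_mul_right (hρs n h) _))
    · simp [V, dif_neg h]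
  refine absurd hδm (not_lt.2 ?_)
  calc m ≤ ν k univ := hmass k
    _ ≤ ν k (K k) + ν k (K k)ᶜ := by
      rw [← union_compl_self (K k)]; exact measure_union_le _ _
    _ = ν k (K k) := by rw [hν, add_zero]
    _ ≤ ∑' n, ν k (V n) := (measure_mono hk).trans (measure_iUnion_le _)
    _ ≤ ∑' n, D * ((⨆ _ : (t n).Nonempty, Metric.ediam (t n) ^ (s : ℝ)) + e n) :=
      ENNReal.tsum_le_tsum hVn
    _ = D * (∑' n, (⨆ _ : (t n).Nonempty, Metric.ediam (t n) ^ (s : ℝ)) + ∑' n, (e n : ℝ≥0∞)) := by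
      rw [ENNReal.tsum_mul_left, ENNReal.tsum_add]
    _ ≤ D * (δ + δ) := mul_le_mul_right (add_le_add htsum.le hesum.le) _

/-- Move the mass that `ν` gives to `P i` uniformly onto `Q i`, for each `i ∈ F`. -/
noncomputable def redistribute {n : ℕ} (ν : Measure (Fin n → ℝ)) (F : Finset ℕ)
    (P Q : ℕ → Set (Fin n → ℝ)) : Measure (Fin n → ℝ) :=
  ∑ i ∈ F, ν (P i) • ProbabilityTheory.cond volume (Q i)

section Redistribute

variable {n : ℕ}

theorem redistribute_apply (ν : Measure (Fin n → ℝ)) (F : Finset ℕ)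
    (P Q : ℕ → Set (Fin n → ℝ)) (S : Set (Fin n → ℝ)) :
    redistribute ν F P Q S = ∑ i ∈ F, ν (P i) * ProbabilityTheory.cond volume (Q i) S := by
  simp [redistribute, Measure.finsetSum_apply]

theorem cond_openBox_closedBall_le {z w y : Fin n → ℝ} (hw : ∀ j, 0 < w j) {ρ : ℝ}
    (hρ : 0 < ρ) :
    ProbabilityTheory.cond volume (openBox z w) (Metric.closedBall y ρ) ≤
      ∏ j, ENNReal.ofReal (min 1 (ρ / w j)) := by
  rw [ProbabilityTheory.cond_apply (isOpen_openBox z w).measurableSet]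
  have h : volume (openBox z w ∩ Metric.closedBall y ρ) ≤
      (∏ j, ENNReal.ofReal (min 1 (ρ / w j))) * volume (openBox z w) := by
    rw [volume_openBox, ← Finset.prod_mul_distrib, closedBall_pi _ hρ.le, openBox,
      ← Set.pi_inter_distrib, volume_pi_pi]
    refine Finset.prod_le_prod' fun j _ => ?_
    rw [← ENNReal.ofReal_mul (le_min zero_le_one (div_nonneg hρ.le (hw j).le)),
      min_mul_of_nonneg _ _ (by linarith [hw j]), one_mul,
      show ρ / w j * (2 * w j) = 2 * ρ by field_simp [(hw j).ne'], ENNReal.ofReal_min]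
    refine le_min ((measure_mono inter_subset_left).trans_eq ?_)
      ((measure_mono inter_subset_right).trans_eq ?_)
    · rw [Real.volume_ball]
    · rw [Real.volume_closedBall]
  calc _ ≤ (volume (openBox z w))⁻¹ *
        ((∏ j, ENNReal.ofReal (min 1 (ρ / w j))) * volume (openBox z w)) :=
        mul_le_mul_right h _
    _ = _ := by
      rw [mul_left_comm, ENNReal.inv_mul_cancel (volume_openBox_ne_zero hw)
        (volume_openBox_ne_top z w), mul_one]

theorem sum_measure_mul_le {ν : Measure (Fin n → ℝ)} {M : ℝ≥0}
    (hν : ν ≤ M • volume) {G : Finset ℕ} {P : ℕ → Set (Fin n → ℝ)}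
    (hPm : ∀ i, MeasurableSet (P i)) (hd : (G : Set ℕ).PairwiseDisjoint P)
    {g : ℕ → ℝ≥0∞} {H : ℝ≥0∞} (hg : ∀ i ∈ G, g i ≤ H) {B : Set (Fin n → ℝ)}
    (hB : ∀ i ∈ G, P i ⊆ B) :
    ∑ i ∈ G, ν (P i) * g i ≤ M * (H * volume B) := by
  calc ∑ i ∈ G, ν (P i) * g i ≤ ∑ i ∈ G, ν (P i) * H :=
        Finset.sum_le_sum fun i hi => mul_le_mul_right (hg i hi) _
    _ = ν (⋃ i ∈ G, P i) * H := by
      rw [measure_biUnion_finset hd fun i _ => hPm i, Finset.sum_mul]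
    _ ≤ (M * volume B) * H := by
      refine mul_le_mul_left ((measure_mono (iUnion₂_subset hB)).trans ?_) _
      exact hν B
    _ = _ := by ring

/-- The scale index below which dyadic scales have to be treated separately. -/
theorem exists_scale_index {a : Fin n → ℝ} (ha : ∀ j, 0 < a j) {ε : ℝ} (hε : 0 < ε) :
    ∃ D : ℝ, 0 ≤ D ∧ ∀ ρ : ℝ, 0 < ρ → ρ ≤ 1 → ∃ L : ℕ,
      (∀ j, ((1 / 2 : ℝ) ^ L) ^ a j ≤ ρ) ∧ (L + 1 : ℝ) ≤ D * ρ ^ (-ε) := by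
  have hl2 : 0 < Real.log 2 := Real.log_pos one_lt_two
  set κ := ∑ j, (a j)⁻¹ with hκ
  have hκ0 : 0 ≤ κ := Finset.sum_nonneg fun j _ => (inv_pos.2 (ha j)).le
  refine ⟨κ / (Real.log 2 * ε) + 2, by positivity, fun ρ hρ hρ1 => ?_⟩
  obtain ⟨u, rfl⟩ : ∃ u, ρ = Real.exp (-u) := ⟨-Real.log ρ, by simp [Real.exp_log hρ]⟩
  have hu : 0 ≤ u := by simpa using hρ1
  refine ⟨⌈κ * u / Real.log 2⌉₊, fun j => ?_, ?_⟩
  · set L := ⌈κ * u / Real.log 2⌉₊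
    have h1 : κ * u / Real.log 2 ≤ L := Nat.le_ceil _
    rw [div_le_iff₀ hl2] at h1
    have h2 : 1 ≤ κ * a j := by
      have : (a j)⁻¹ ≤ κ :=
        Finset.single_le_sum (f := fun j => (a j)⁻¹) (fun i _ => (inv_pos.2 (ha i)).le)
          (Finset.mem_univ j)
      calc (1 : ℝ) = (a j)⁻¹ * a j := (inv_mul_cancel₀ (ha j).ne').symm
        _ ≤ _ := mul_le_mul_of_nonneg_right this (ha j).le
    have h3 : (1 / 2 : ℝ) ^ L = Real.exp (-(L * Real.log 2)) := by
      rw [← mul_neg, ← Real.log_inv, Real.exp_nat_mul, Real.exp_log (by norm_num), one_div]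
    rw [h3, ← Real.exp_mul, Real.exp_le_exp]
    nlinarith [mul_le_mul_of_nonneg_right h1 (ha j).le, mul_le_mul_of_nonneg_right h2 hu]
  · rw [← Real.exp_mul, neg_mul_neg]
    have h1 := (Nat.ceil_lt_add_one (a := κ * u / Real.log 2) (by positivity)).le
    have h2 : 1 + u * ε ≤ Real.exp (u * ε) := by linarith [Real.add_one_le_exp (u * ε)]
    have h3 : κ * u / Real.log 2 = κ / (Real.log 2 * ε) * (u * ε) := by field_simp
    have h4 : 0 ≤ κ / (Real.log 2 * ε) := by positivity
    nlinarith [mul_le_mul_of_nonneg_left h2 h4, mul_nonneg hu hε.le]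

theorem prod_min_mul_le (hn : 0 < n) {a t : Fin n → ℝ} (ha : ∀ j, 0 < a j)
    (ht : ∀ j, 0 ≤ t j) {c C : ℝ} (hc : 0 < c) (hc1 : c ≤ 1) (hC : 0 ≤ C) {ρ σ : ℝ}
    (hρ : 0 < ρ) (hρ1 : ρ ≤ 1) (hσ : 0 < σ) (hσ1 : σ ≤ 1) :
    ∏ j, (min 1 (ρ / (c * σ ^ (a j + t j))) * (2 * (ρ + 2 * (C * σ ^ a j)))) ≤
      ((2 + 4 * C) / c) ^ n * ρ ^ mtprrBound n a t := by
  calc _ ≤ ∏ j, ((2 + 4 * C) / c * (max ρ (σ ^ a j) * min 1 (ρ / σ ^ (a j + t j)))) := by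
        refine Finset.prod_le_prod (fun j _ => by positivity) fun j _ => ?_
        have h1 : min 1 (ρ / (c * σ ^ (a j + t j))) ≤ c⁻¹ * min 1 (ρ / σ ^ (a j + t j)) := by
          rw [mul_min_of_nonneg _ _ (inv_nonneg.2 hc.le), mul_one]
          refine min_le_min (one_le_inv_iff₀.2 ⟨hc, hc1⟩) (le_of_eq ?_)
          rw [div_mul_eq_div_div, div_right_comm, div_eq_inv_mul]
        have h2 : 2 * (ρ + 2 * (C * σ ^ a j)) ≤ (2 + 4 * C) * max ρ (σ ^ a j) := by
          nlinarith [le_max_left ρ (σ ^ a j), mul_le_mul_of_nonneg_left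
            (le_max_right ρ (σ ^ a j)) hC]
        calc _ ≤ (c⁻¹ * min 1 (ρ / σ ^ (a j + t j))) * ((2 + 4 * C) * max ρ (σ ^ a j)) :=
              mul_le_mul h1 h2 (by positivity) (by positivity)
          _ = _ := by rw [div_eq_mul_inv]; ring
    _ ≤ _ := by
      rw [Finset.prod_mul_distrib, Finset.prod_const, Finset.card_univ, Fintype.card_fin]
      exact mul_le_mul_of_nonneg_left (prod_max_mul_min_le hn a t ha ht hρ hρ1 hσ hσ1)
        (by positivity)

theorem prod_small_le (hn : 0 < n) {a t : Fin n → ℝ} (ha : ∀ j, 0 < a j)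
    (ht : ∀ j, 0 ≤ t j) {c C : ℝ} (hc : 0 < c) (hc1 : c ≤ 1) (hC : 0 ≤ C) {ρ σ : ℝ}
    (hρ : 0 < ρ) (hρ1 : ρ ≤ 1) (hσ : 0 < σ) (hσρ : ∀ j, σ ^ a j ≤ ρ) :
    ∏ j, (2 * (ρ + 2 * (C * σ ^ a j))) ≤ ((2 + 4 * C) / c) ^ n * ρ ^ mtprrBound n a t := by
  calc _ ≤ ∏ _j : Fin n, ((2 + 4 * C) / c * ρ) := by
        refine Finset.prod_le_prod (fun j _ => by positivity) fun j _ => ?_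
        calc 2 * (ρ + 2 * (C * σ ^ a j)) ≤ (2 + 4 * C) * ρ := by
              nlinarith [mul_le_mul_of_nonneg_left (hσρ j) hC]
          _ ≤ _ := by
            gcongr
            exact le_div_self (by positivity) hc hc1
    _ = ((2 + 4 * C) / c) ^ n * ρ ^ (n : ℝ) := by
      rw [Finset.prod_const, Finset.card_univ, Fintype.card_fin, mul_pow, Real.rpow_natCast]
    _ ≤ _ := by
      refine mul_le_mul_of_nonneg_left ?_ (by positivity)
      exact Real.rpow_le_rpow_of_exponent_ge hρ hρ1 (mtprrBound_le hn a t ha ht)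

/-- Uniform Frostman estimate for redistributed measures at small radii. -/
theorem exists_redistribute_closedBall_le (hn : 0 < n) {a t : Fin n → ℝ} (ha : ∀ j, 0 < a j)
    (ht : ∀ j, 0 ≤ t j) {c C : ℝ} (hc : 0 < c) (hc1 : c ≤ 1) (hC : 0 ≤ C)
    (x z : ℕ → Fin n → ℝ) (m : ℕ → ℕ) {s : ℝ} (hs : s < mtprrBound n a t) :
    ∃ D : ℝ, 0 ≤ D ∧ ∀ (F : Finset ℕ) (P Q : ℕ → Set (Fin n → ℝ)),
      (∀ i, P i = closedBox (x i) fun j => C * ((1 / 2 : ℝ) ^ m i) ^ a j) →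
      (∀ i, Q i = openBox (z i) fun j => c * ((1 / 2 : ℝ) ^ m i) ^ (a j + t j)) →
      (F : Set ℕ).PairwiseDisjoint P → (∀ i ∈ F, Q i ⊆ P i) →
      ∀ (ν : Measure (Fin n → ℝ)) (M : ℝ≥0), ν ≤ M • volume →
      ∀ (y : Fin n → ℝ) (ρ : ℝ), 0 < ρ → ρ ≤ 1 →
        redistribute ν F P Q (Metric.closedBall y ρ) ≤ M * ENNReal.ofReal (D * ρ ^ s) := by
  classical
  obtain ⟨D, hD, hL⟩ := exists_scale_index ha (sub_pos.2 hs)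
  set D₁ := ((2 + 4 * C) / c) ^ n with hD₁
  have hD₁0 : 0 ≤ D₁ := by positivity
  refine ⟨D₁ * D, by positivity, ?_⟩
  intro F P Q hP hQ hd hQP ν M hν y ρ hρ hρ1
  obtain ⟨L, hLρ, hLD⟩ := hL ρ hρ hρ1
  have hσ : ∀ k, 0 < (1 / 2 : ℝ) ^ k := fun k => by positivity
  have hPm : ∀ i, MeasurableSet (P i) := fun i => hP i ▸ measurableSet_closedBox _ _
  set B := Metric.closedBall y ρ with hB
  set g : ℕ → ℝ≥0∞ := fun i => ProbabilityTheory.cond volume (Q i) B with hg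
  set F' := F.filter fun i => (Q i ∩ B).Nonempty with hF'
  have hF'F : F' ⊆ F := Finset.filter_subset _ _
  have hsum : ∑ i ∈ F, ν (P i) * g i = ∑ i ∈ F', ν (P i) * g i := by
    refine (Finset.sum_filter_of_ne fun i _ hi => ?_).symm
    by_contra hne
    rw [not_nonempty_iff_eq_empty] at hne
    apply hi
    simp only [hg]
    rw [ProbabilityTheory.cond_apply (hQ i ▸ (isOpen_openBox _ _).measurableSet), hne]
    simp
  have hsub : ∀ i ∈ F', ∀ k, k ≤ m i →
      P i ⊆ closedBox y fun j => ρ + 2 * (C * ((1 / 2 : ℝ) ^ k) ^ a j) := by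
    intro i hi k hk p hp
    obtain ⟨hiF, q, hqQ, hqB⟩ := Finset.mem_filter.1 hi
    have hqP := hQP i hiF hqQ
    rw [hP, mem_closedBox] at hp hqP
    rw [hB, closedBall_pi _ hρ.le] at hqB
    refine mem_closedBox.2 fun j => ?_
    have h1 : |q j - y j| ≤ ρ := by simpa [Real.dist_eq] using hqB j (mem_univ j)
    have h2 : ((1 / 2 : ℝ) ^ m i) ^ a j ≤ ((1 / 2 : ℝ) ^ k) ^ a j :=
      Real.rpow_le_rpow (hσ _).le
        (pow_le_pow_of_le_one (by norm_num) (by norm_num) hk) (ha j).le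
    have h3 := mul_le_mul_of_nonneg_left h2 hC
    have h4 : |p j - y j| ≤ |p j - x i j| + |q j - x i j| + |q j - y j| := by
      rw [show p j - y j = (p j - x i j) - (q j - x i j) + (q j - y j) by ring]
      exact (abs_add_le _ _).trans (add_le_add_left (abs_sub _ _) _)
    linarith [hp j, hqP j]
  have hgroup : ∀ k ∈ Finset.range (L + 1),
      ∑ i ∈ F' with min (m i) L = k, ν (P i) * g i ≤
        M * ENNReal.ofReal (D₁ * ρ ^ mtprrBound n a t) := by
    intro k hk
    have hd' : ((F'.filter fun i => min (m i) L = k : Finset ℕ) : Set ℕ).PairwiseDisjoint P :=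
      hd.subset (Finset.coe_subset.2 ((Finset.filter_subset _ _).trans hF'F))
    have hkm : ∀ i ∈ F'.filter (fun i => min (m i) L = k),
        P i ⊆ closedBox y fun j => ρ + 2 * (C * ((1 / 2 : ℝ) ^ k) ^ a j) := fun i hi =>
      hsub i (Finset.mem_filter.1 hi).1 k
        ((Finset.mem_filter.1 hi).2 ▸ min_le_left _ _)
    rcases (Nat.lt_succ_iff.1 (Finset.mem_range.1 hk)).eq_or_lt with h | h
    · subst h
      refine (sum_measure_mul_le hν hPm hd' (H := 1) (fun i _ => ?_) hkm).trans ?_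
      · exact prob_le_one
      · rw [one_mul, volume_closedBox, ← ENNReal.ofReal_prod_of_nonneg fun j _ => by positivity]
        exact mul_le_mul_right (ENNReal.ofReal_le_ofReal
          (prod_small_le hn ha ht hc hc1 hC hρ hρ1 (hσ k) hLρ)) _
    · refine (sum_measure_mul_le hν hPm hd' (H := ∏ j, ENNReal.ofReal
        (min 1 (ρ / (c * ((1 / 2 : ℝ) ^ k) ^ (a j + t j))))) (fun i hi => ?_) hkm).trans ?_
      · have hik : m i = k := by
          have := (Finset.mem_filter.1 hi).2
          omega
        simp only [hg, hQ, hik]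
        exact cond_openBox_closedBall_le (fun j => by positivity) hρ
      · rw [volume_closedBox, ← Finset.prod_mul_distrib]
        simp only [← ENNReal.ofReal_mul' (show 0 ≤ 2 * (ρ + 2 * (C * ((1 / 2 : ℝ) ^ k) ^ a _)) by
          positivity)]
        rw [← ENNReal.ofReal_prod_of_nonneg fun j _ => by positivity]
        exact mul_le_mul_right (ENNReal.ofReal_le_ofReal
          (prod_min_mul_le hn ha ht hc hc1 hC hρ hρ1 (hσ k)
            (pow_le_one₀ (by norm_num) (by norm_num)))) _
  rw [redistribute_apply, hsum, ← Finset.sum_fiberwise_of_maps_to (t := Finset.range (L + 1))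
    (g := fun i => min (m i) L) (fun i _ => Finset.mem_range.2 (by omega))]
  refine (Finset.sum_le_card_nsmul _ _ _ hgroup).trans ?_
  rw [Finset.card_range, nsmul_eq_mul, mul_left_comm]
  refine mul_le_mul_right ?_ _
  rw [← ENNReal.ofReal_natCast, ← ENNReal.ofReal_mul (by positivity)]
  refine ENNReal.ofReal_le_ofReal ?_
  push_cast
  calc (L + 1 : ℝ) * (D₁ * ρ ^ mtprrBound n a t)
      ≤ (D * ρ ^ (-(mtprrBound n a t - s))) * (D₁ * ρ ^ mtprrBound n a t) :=
        mul_le_mul_of_nonneg_right hLD (by positivity)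
    _ = D₁ * D * (ρ ^ (-(mtprrBound n a t - s)) * ρ ^ mtprrBound n a t) := by ring
    _ = _ := by rw [← Real.rpow_add hρ]; congr 2; ring

end Redistribute

section RedistributeBasic

variable {n : ℕ} {ν : Measure (Fin n → ℝ)} {F : Finset ℕ} {P Q : ℕ → Set (Fin n → ℝ)}

theorem redistribute_univ (hPm : ∀ i, MeasurableSet (P i)) (hd : (F : Set ℕ).PairwiseDisjoint P)
    (hQ0 : ∀ i, volume (Q i) ≠ 0) (hQt : ∀ i, volume (Q i) ≠ ∞) :
    redistribute ν F P Q univ = ν (⋃ i ∈ F, P i) := by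
  rw [redistribute_apply, measure_biUnion_finset hd fun i _ => hPm i]
  refine Finset.sum_congr rfl fun i _ => ?_
  have := ProbabilityTheory.cond_isProbabilityMeasure_of_finite (hQ0 i) (hQt i)
  rw [measure_univ, mul_one]

theorem redistribute_compl_eq_zero (hQm : ∀ i, MeasurableSet (Q i)) :
    redistribute ν F P Q (⋃ i ∈ F, Q i)ᶜ = 0 := by
  rw [redistribute_apply]
  refine Finset.sum_eq_zero fun i hi => ?_
  rw [ProbabilityTheory.cond_apply (hQm i)]
  have : Q i ∩ (⋃ i ∈ F, Q i)ᶜ = ∅ := by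
    rw [← disjoint_iff_inter_eq_empty, disjoint_compl_right_iff_subset]
    exact subset_biUnion_of_mem (u := Q) (Finset.mem_coe.2 hi)
  rw [this, measure_empty, mul_zero, mul_zero]

theorem exists_redistribute_le_smul_volume (hν : ν univ ≠ ∞) (hQm : ∀ i, MeasurableSet (Q i))
    (hQ0 : ∀ i, volume (Q i) ≠ 0) : ∃ M : ℝ≥0, redistribute ν F P Q ≤ M • volume := by
  have hfin : ∑ i ∈ F, ν (P i) * (volume (Q i))⁻¹ ≠ ∞ :=
    ENNReal.sum_ne_top.2 fun i _ => ENNReal.mul_ne_top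
      (ne_top_of_le_ne_top hν (measure_mono (subset_univ _))) (ENNReal.inv_ne_top.2 (hQ0 i))
  refine ⟨(∑ i ∈ F, ν (P i) * (volume (Q i))⁻¹).toNNReal, Measure.le_iff'.2 fun S => ?_⟩
  rw [redistribute_apply, Measure.smul_apply, ENNReal.smul_def, ENNReal.coe_toNNReal hfin,
    smul_eq_mul, Finset.sum_mul]
  refine Finset.sum_le_sum fun i _ => ?_
  rw [ProbabilityTheory.cond_apply (hQm i), mul_assoc]
  gcongr
  exact inter_subset_right

theorem redistribute_closedBall_le_add (hPm : ∀ i, MeasurableSet (P i))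
    (hQm : ∀ i, MeasurableSet (Q i)) (hd : (F : Set ℕ).PairwiseDisjoint P)
    (hQP : ∀ i ∈ F, Q i ⊆ P i) {δ : ℝ} (hδ : ∀ i ∈ F, ∀ p ∈ P i, ∀ q ∈ P i, dist p q ≤ δ)
    (y : Fin n → ℝ) (ρ : ℝ) :
    redistribute ν F P Q (Metric.closedBall y ρ) ≤ ν (Metric.closedBall y (ρ + δ)) := by
  classical
  set F' := F.filter fun i => (Q i ∩ Metric.closedBall y ρ).Nonempty with hF'
  have hd' : (F' : Set ℕ).PairwiseDisjoint P :=
    hd.subset (Finset.coe_subset.2 (Finset.filter_subset _ _))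
  have hsum : ∑ i ∈ F, ν (P i) * ProbabilityTheory.cond volume (Q i) (Metric.closedBall y ρ) =
      ∑ i ∈ F', ν (P i) * ProbabilityTheory.cond volume (Q i) (Metric.closedBall y ρ) := by
    refine (Finset.sum_filter_of_ne fun i _ hi => ?_).symm
    by_contra hne
    rw [not_nonempty_iff_eq_empty] at hne
    apply hi
    rw [ProbabilityTheory.cond_apply (hQm i), hne]
    simp
  calc redistribute ν F P Q (Metric.closedBall y ρ)
      = ∑ i ∈ F', ν (P i) * ProbabilityTheory.cond volume (Q i) (Metric.closedBall y ρ) := by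
        rw [redistribute_apply, hsum]
    _ ≤ ∑ i ∈ F', ν (P i) := Finset.sum_le_sum fun i _ => mul_le_of_le_one_right' prob_le_one
    _ = ν (⋃ i ∈ F', P i) := (measure_biUnion_finset hd' fun i _ => hPm i).symm
    _ ≤ _ := by
      refine measure_mono (iUnion₂_subset fun i hi p hp => ?_)
      obtain ⟨hiF, q, hqQ, hqB⟩ := Finset.mem_filter.1 hi
      rw [Metric.mem_closedBall] at hqB ⊢
      linarith [dist_triangle p q y, hδ i hiF p hp q (hQP i hiF hqQ)]

end RedistributeBasic

/-- A measure of mass in `(1/2, 1]` carried by an open set `U ⊆ O`, with bounded density and with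
`s`-Frostman constant less than `D`. -/
structure IsStage {n : ℕ} (O : Set (Fin n → ℝ)) (s D : ℝ) (ν : Measure (Fin n → ℝ))
    (U : Set (Fin n → ℝ)) : Prop where
  isOpen : IsOpen U
  subset : U ⊆ O
  null : ν Uᶜ = 0
  density : ∃ M : ℝ≥0, ν ≤ M • volume
  mass : 1 / 2 < ν univ
  mass_le : ν univ ≤ 1
  frostman : ∃ C : ℝ, 0 ≤ C ∧ C < D ∧ ∀ (y : Fin n → ℝ) (ρ : ℝ), 0 < ρ →
    ν (Metric.closedBall y ρ) ≤ ENNReal.ofReal (C * ρ ^ s)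

section Construction

variable {n : ℕ}

theorem isStage_initial {O : Set (Fin n → ℝ)} (hO : IsOpen O) (hO1 : volume O = 1) {s : ℝ}
    (hs0 : 0 ≤ s) (hsn : s ≤ n) : IsStage O s (2 ^ n + 1) (volume.restrict O) O where
  isOpen := hO
  subset := Subset.rfl
  null := by rw [Measure.restrict_apply hO.measurableSet.compl]; simp
  density := ⟨1, by simpa using Measure.restrict_le_self⟩
  mass := by simp [hO1]
  mass_le := by simp [hO1]
  frostman := by
    refine ⟨2 ^ n, by positivity, by linarith, fun y ρ hρ => ?_⟩
    rcases le_total ρ 1 with h | h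
    · refine (Measure.restrict_le_self _).trans ?_
      rw [Real.volume_pi_closedBall _ hρ.le]
      refine ENNReal.ofReal_le_ofReal ?_
      rw [Fintype.card_fin, mul_pow, ← Real.rpow_natCast ρ]
      gcongr ?_ * ?_
      exact Real.rpow_le_rpow_of_exponent_ge hρ h hsn
    · refine (measure_mono (subset_univ _)).trans ?_
      rw [Measure.restrict_apply_univ, hO1]
      refine ENNReal.one_le_ofReal.2 ?_
      exact one_le_mul_of_one_le_of_one_le (one_le_pow₀ one_le_two) (Real.one_le_rpow h hs0)

/-- A radius below which a bound of higher order is better than the target bound. -/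
theorem exists_radius (K : ℝ) {s s' : ℝ} (hss : s < s') :
    ∃ ρ₀ : ℝ, 0 < ρ₀ ∧ ρ₀ ≤ 1 ∧ ∀ ρ, 0 < ρ → ρ ≤ ρ₀ → K * ρ ^ s' ≤ ρ ^ s := by
  have he : 0 < s' - s := sub_pos.2 hss
  have h1 : Tendsto (fun ρ : ℝ => K * ρ ^ (s' - s)) (nhds 0) (nhds 0) := by
    have := ((Real.continuousAt_rpow_const 0 (s' - s) (Or.inr he.le)).tendsto).const_mul K
    rwa [Real.zero_rpow he.ne', mul_zero] at this
  obtain ⟨ε, hε, hball⟩ := Metric.eventually_nhds_iff.1 (h1.eventually (gt_mem_nhds one_pos))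
  refine ⟨min (ε / 2) 1, by positivity, min_le_right _ _, fun ρ hρ hle => ?_⟩
  have h2 := hball (y := ρ) (by
    rw [Real.dist_eq, sub_zero, abs_of_pos hρ]; linarith [hle.trans (min_le_left _ _)])
  calc K * ρ ^ s' = K * ρ ^ (s' - s) * ρ ^ s := by
        rw [mul_assoc, ← Real.rpow_add hρ, sub_add_cancel]
    _ ≤ 1 * ρ ^ s := mul_le_mul_of_nonneg_right h2.le (by positivity)
    _ = _ := one_mul _

theorem exists_enlargement {C C' s ρ₀ : ℝ} (hC : C < C') (hC0 : 0 ≤ C) (hs : 0 ≤ s)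
    (hρ₀ : 0 < ρ₀) :
    ∃ δ : ℝ, 0 < δ ∧ ∀ ρ, ρ₀ ≤ ρ → C * (ρ + δ) ^ s ≤ C' * ρ ^ s := by
  have h1 : Tendsto (fun δ : ℝ => C * (1 + δ) ^ s) (nhds 0) (nhds C) := by
    have : ContinuousAt (fun δ : ℝ => C * (1 + δ) ^ s) 0 :=
      continuousAt_const.mul ((continuousAt_const.add continuousAt_id).rpow_const (Or.inr hs))
    simpa [ContinuousAt] using this
  obtain ⟨ε, hε, hball⟩ := Metric.eventually_nhds_iff.1 (h1.eventually (gt_mem_nhds hC))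
  refine ⟨ε / 2 * ρ₀, by positivity, fun ρ hρ => ?_⟩
  have hρ0 : 0 < ρ := hρ₀.trans_le hρ
  have h2 := hball (y := ε / 2) (by rw [Real.dist_eq, sub_zero, abs_of_pos (by positivity)]; linarith)
  calc C * (ρ + ε / 2 * ρ₀) ^ s ≤ C * ((1 + ε / 2) * ρ) ^ s := by
        gcongr
        nlinarith
    _ = C * (1 + ε / 2) ^ s * ρ ^ s := by
      rw [Real.mul_rpow (by positivity) hρ0.le, mul_assoc]
    _ ≤ _ := mul_le_mul_of_nonneg_right h2.le (by positivity)

theorem exists_next_stage (hn : 0 < n) {a t : Fin n → ℝ} (ha : ∀ j, 0 < a j)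
    (ht : ∀ j, 0 ≤ t j) {c C : ℝ} (hc : 0 < c) (hc1 : c ≤ 1) (hC : 0 < C)
    (x z : ℕ → Fin n → ℝ) {m : ℕ → ℕ} (hm : Tendsto m atTop atTop)
    {O : Set (Fin n → ℝ)} (hO1 : volume O = 1)
    (hcov : volume (O \ limsup
      (fun i => closedBox (x i) fun j => C * ((1 / 2 : ℝ) ^ m i) ^ a j) atTop) = 0)
    (hQP : ∀ᶠ i in atTop, closedBox (z i) (fun j => c * ((1 / 2 : ℝ) ^ m i) ^ (a j + t j)) ⊆
      closedBox (x i) fun j => C * ((1 / 2 : ℝ) ^ m i) ^ a j)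
    {s D : ℝ} (hs0 : 0 ≤ s) (hs : s < mtprrBound n a t) (hD : 1 < D)
    {ν : Measure (Fin n → ℝ)} {U : Set (Fin n → ℝ)} (hU : IsStage O s D ν U) (N : ℕ) :
    ∃ (ν' : Measure (Fin n → ℝ)) (U' K : Set (Fin n → ℝ)), IsStage O s D ν' U' ∧
      IsCompact K ∧ U' ⊆ K ∧ K ⊆ U ∧
      K ⊆ ⋃ i ≥ N, closedBox (z i) fun j => c * ((1 / 2 : ℝ) ^ m i) ^ (a j + t j) := by
  set σ : ℕ → ℝ := fun i => (1 / 2 : ℝ) ^ m i with hσ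
  have hσ0 : ∀ i, 0 < σ i := fun i => by positivity
  have hσ1 : ∀ i, σ i ≤ 1 := fun i => pow_le_one₀ (by norm_num) (by norm_num)
  have hσt : Tendsto σ atTop (nhds 0) :=
    (tendsto_pow_atTop_nhds_zero_of_lt_one (by norm_num) (by norm_num)).comp hm
  set P : ℕ → Set (Fin n → ℝ) := fun i => closedBox (x i) fun j => C * σ i ^ a j with hP
  set Q : ℕ → Set (Fin n → ℝ) := fun i => openBox (z i) fun j => c * σ i ^ (a j + t j) with hQ
  have hPm : ∀ i, MeasurableSet (P i) := fun i => measurableSet_closedBox _ _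
  have hQm : ∀ i, MeasurableSet (Q i) := fun i => (isOpen_openBox _ _).measurableSet
  have hw : ∀ i j, 0 < c * σ i ^ (a j + t j) := fun i j => by positivity
  obtain ⟨M, hM⟩ := hU.density
  obtain ⟨C₀, hC₀, hC₀D, hfrost⟩ := hU.frostman
  obtain ⟨s', hss', hs'⟩ := exists_between hs
  obtain ⟨D₁, hD₁, hsmall⟩ := exists_redistribute_closedBall_le hn ha ht hc hc1 hC.le x z m hs'
  obtain ⟨C₁, hC₁, hC₁D⟩ := exists_between (max_lt hC₀D hD)
  obtain ⟨hC₀₁, h1C₁⟩ := max_lt_iff.1 hC₁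
  obtain ⟨ρ₀, hρ₀, hρ₀1, hradius⟩ := exists_radius (M * D₁) hss'
  obtain ⟨δ, hδ, henl⟩ := exists_enlargement hC₀₁ hC₀ hs0 hρ₀
  have hPsmall : ∀ᶠ i in atTop, ∀ j, 2 * (C * σ i ^ a j) < δ := by
    refine eventually_all.2 fun j => ?_
    have : Tendsto (fun i => 2 * (C * σ i ^ a j)) atTop (nhds (2 * (C * 0 ^ a j))) :=
      ((hσt.rpow_const (Or.inr (ha j).le)).const_mul C).const_mul 2
    rw [Real.zero_rpow (ha j).ne', mul_zero, mul_zero] at this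
    exact this.eventually (gt_mem_nhds hδ)
  obtain ⟨N₁, hN₁⟩ := eventually_atTop.1 (hPsmall.and hQP)
  obtain ⟨η, hη, hηm⟩ : ∃ η : ℝ≥0∞, η ≠ 0 ∧ 1 / 2 + M * η < ν univ := by
    have h1 : Tendsto (fun η : ℝ≥0∞ => 1 / 2 + M * η) (nhds 0) (nhds (1 / 2 + M * 0)) :=
      tendsto_const_nhds.add (ENNReal.Tendsto.const_mul tendsto_id (Or.inr ENNReal.coe_ne_top))
    rw [mul_zero, add_zero] at h1
    have h2 : ∀ᶠ η in nhdsWithin (0 : ℝ≥0∞) {0}ᶜ, 1 / 2 + M * η < ν univ :=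
      eventually_nhdsWithin_of_eventually_nhds (h1.eventually (gt_mem_nhds hU.mass))
    obtain ⟨η, h3, h4⟩ := (h2.and eventually_mem_nhdsWithin).exists
    exact ⟨η, h4, h3⟩
  have hUfin : volume U ≠ ∞ :=
    ne_top_of_le_ne_top ENNReal.one_ne_top (hO1 ▸ measure_mono hU.subset)
  obtain ⟨F, hF, hd, hvol⟩ := exists_finset_disjoint_closedBox ha x hσ0 hσ1 hσt hC hU.isOpen
    hUfin (measure_mono_null (sdiff_subset_sdiff_left hU.subset) hcov) (max N N₁) hη
  have hFN : ∀ i ∈ F, N ≤ i := fun i hi => (le_max_left _ _).trans (hF i hi).1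
  have hFN₁ : ∀ i ∈ F, N₁ ≤ i := fun i hi => (le_max_right _ _).trans (hF i hi).1
  have hQcP : ∀ i ∈ F, closedBox (z i) (fun j => c * σ i ^ (a j + t j)) ⊆ P i :=
    fun i hi => (hN₁ i (hFN₁ i hi)).2
  have hQP' : ∀ i ∈ F, Q i ⊆ P i :=
    fun i hi => (openBox_subset_closedBox _ _).trans (hQcP i hi)
  have hdiam : ∀ i ∈ F, ∀ p ∈ P i, ∀ q ∈ P i, dist p q ≤ δ := by
    intro i hi p hp q hq
    rw [dist_pi_le_iff hδ.le]
    intro j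
    have h1 := mem_closedBox.1 hp j
    have h2 := mem_closedBox.1 hq j
    have h3 := (hN₁ i (hFN₁ i hi)).1 j
    rw [Real.dist_eq, show p j - q j = (p j - x i j) - (q j - x i j) by ring]
    exact (abs_sub _ _).trans (by linarith)
  have huniv : redistribute ν F P Q univ = ν (⋃ i ∈ F, P i) :=
    redistribute_univ hPm hd (fun i => volume_openBox_ne_zero (hw i))
      fun i => volume_openBox_ne_top _ _
  refine ⟨redistribute ν F P Q, ⋃ i ∈ F, Q i,
    ⋃ i ∈ F, closedBox (z i) fun j => c * σ i ^ (a j + t j), ?_, ?_, ?_, ?_, ?_⟩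
  · refine ⟨isOpen_biUnion fun i _ => isOpen_openBox _ _, ?_, redistribute_compl_eq_zero hQm,
      exists_redistribute_le_smul_volume (ne_top_of_le_ne_top ENNReal.one_ne_top hU.mass_le) hQm
        fun i => volume_openBox_ne_zero (hw i), ?_, ?_, C₁, hC₀.trans hC₀₁.le, hC₁D, ?_⟩
    · exact (iUnion₂_subset fun i hi => (hQP' i hi).trans (hF i hi).2).trans hU.subset
    · have h1 : ν univ ≤ ν (⋃ i ∈ F, P i) + M * η := by
        calc ν univ ≤ ν ((⋃ i ∈ F, P i) ∪ (U \ ⋃ i ∈ F, P i) ∪ Uᶜ) := by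
              refine measure_mono fun p _ => ?_
              by_cases h : p ∈ U <;> by_cases h' : p ∈ ⋃ i ∈ F, P i
              · exact Or.inl (Or.inl h')
              · exact Or.inl (Or.inr ⟨h, h'⟩)
              · exact Or.inr h
              · exact Or.inr h
          _ ≤ ν (⋃ i ∈ F, P i) + ν (U \ ⋃ i ∈ F, P i) + ν Uᶜ :=
            (measure_union_le _ _).trans (add_le_add_left (measure_union_le _ _) _)
          _ ≤ _ := by
            rw [hU.null, add_zero]
            refine add_le_add_right ((hM _).trans ?_) _
            exact mul_le_mul_right hvol _
      rw [huniv]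
      by_contra! h
      exact absurd (hηm.trans_le (h1.trans (add_le_add_left h _))) (lt_irrefl _)
    · rw [huniv]
      exact (measure_mono (subset_univ _)).trans hU.mass_le
    · intro y ρ hρ
      rcases le_total ρ ρ₀ with h | h
      · refine (hsmall F P Q (fun _ => rfl) (fun _ => rfl) hd hQP' ν M hM y ρ hρ
          (h.trans hρ₀1)).trans ?_
        rw [← ENNReal.ofReal_coe_nnreal, ← ENNReal.ofReal_mul M.coe_nonneg]
        refine ENNReal.ofReal_le_ofReal ?_
        rw [← mul_assoc]
        refine (hradius ρ hρ h).trans ?_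
        exact le_mul_of_one_le_left (by positivity) h1C₁.le
      · exact (redistribute_closedBall_le_add hPm hQm hd hQP' hdiam y ρ).trans
          ((hfrost y (ρ + δ) (by positivity)).trans (ENNReal.ofReal_le_ofReal (henl ρ h)))
  · exact F.isCompact_biUnion fun i _ => isCompact_closedBox _ _
  · exact iUnion₂_mono fun i _ => openBox_subset_closedBox _ _
  · exact iUnion₂_subset fun i hi => (hQcP i hi).trans (hF i hi).2
  · exact iUnion₂_subset fun i hi p hp => mem_iUnion₂.2 ⟨i, hFN i hi, hp⟩

/-- The mass transference principle for boxes at dyadic scales. -/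
theorem le_dimH_limsup_closedBox (hn : 0 < n) {a t : Fin n → ℝ} (ha : ∀ j, 0 < a j)
    (ht : ∀ j, 0 ≤ t j) {c C : ℝ} (hc : 0 < c) (hc1 : c ≤ 1) (hC : 0 < C)
    (x z : ℕ → Fin n → ℝ) {m : ℕ → ℕ} (hm : Tendsto m atTop atTop)
    {O : Set (Fin n → ℝ)} (hO : IsOpen O) (hO1 : volume O = 1)
    (hcov : volume (O \ limsup
      (fun i => closedBox (x i) fun j => C * ((1 / 2 : ℝ) ^ m i) ^ a j) atTop) = 0)
    (hQP : ∀ᶠ i in atTop, closedBox (z i) (fun j => c * ((1 / 2 : ℝ) ^ m i) ^ (a j + t j)) ⊆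
      closedBox (x i) fun j => C * ((1 / 2 : ℝ) ^ m i) ^ a j) :
    ENNReal.ofReal (mtprrBound n a t) ≤ dimH (limsup
      (fun i => closedBox (z i) fun j => c * ((1 / 2 : ℝ) ^ m i) ^ (a j + t j)) atTop) := by
  refine ENNReal.le_of_forall_nnreal_lt fun s hs => ?_
  have hs : (s : ℝ) < mtprrBound n a t := by
    rwa [← ENNReal.ofReal_coe_nnreal, ENNReal.ofReal_lt_ofReal_iff_of_nonneg s.coe_nonneg] at hs
  set D : ℝ := 2 ^ n + 1 with hD
  have hD1 : 1 < D := by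
    have : (0 : ℝ) < 2 ^ n := by positivity
    linarith
  let S := {p : Measure (Fin n → ℝ) × Set (Fin n → ℝ) // IsStage O s D p.1 p.2}
  have hstep : ∀ (N : ℕ) (p : S), ∃ (q : S) (K : Set (Fin n → ℝ)), IsCompact K ∧ q.1.2 ⊆ K ∧
      K ⊆ p.1.2 ∧
      K ⊆ ⋃ i ≥ N, closedBox (z i) fun j => c * ((1 / 2 : ℝ) ^ m i) ^ (a j + t j) := by
    intro N p
    obtain ⟨ν', U', K, h, hK⟩ :=
      exists_next_stage hn ha ht hc hc1 hC x z hm hO1 hcov hQP s.2 hs hD1 p.2 N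
    exact ⟨⟨(ν', U'), h⟩, K, hK⟩
  choose next K hKc hUK hKU hKlim using hstep
  let p : ℕ → S := fun k => Nat.rec
    ⟨(volume.restrict O, O), isStage_initial hO hO1 s.2 (hs.le.trans (mtprrBound_le hn a t ha ht))⟩
    (fun k q => next k q) k
  have hp : ∀ k, p (k + 1) = next k (p k) := fun k => rfl
  have hanti : Antitone fun k => K k (p k) := antitone_nat_of_succ_le fun k =>
    (hKU (k + 1) (p (k + 1))).trans (by rw [hp]; exact hUK k (p k))
  have hdim : (s : ℝ≥0∞) ≤ dimH (⋂ k, K k (p k)) := by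
    refine le_dimH_iInter_of_measure_closedBall_le (fun k => hKc k (p k)) hanti
      (fun k => (p (k + 1)).1.1) (fun k => ?_) (m := 1 / 2) (by simp)
      (fun k => (p (k + 1)).2.mass.le) (D := D.toNNReal) fun k y ρ hρ => ?_
    · refine measure_mono_null (compl_subset_compl.2 ?_) (p (k + 1)).2.null
      rw [hp]
      exact hUK k (p k)
    · obtain ⟨C', -, hC'D, hball⟩ := (p (k + 1)).2.frostman
      refine (hball y ρ hρ).trans ?_
      rw [ENNReal.ofReal_mul' (by positivity), ← ENNReal.ofReal_rpow_of_pos hρ]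
      exact mul_le_mul_left (ENNReal.ofReal_le_ofReal hC'D.le) _
  refine hdim.trans (dimH_mono fun q hq => ?_)
  rw [mem_limsup_iff_frequently_mem, frequently_atTop]
  intro N
  obtain ⟨i, hi, hqi⟩ := mem_iUnion₂.1 (hKlim N (p N) (mem_iInter.1 hq N))
  exact ⟨i, hi, hqi⟩

end Construction

theorem unitCube_inter_null_of_full {n : ℕ} {S : Set (Fin n → ℝ)} (hS : MeasurableSet S)
    (hfull : volume (unitCube n ∩ S) = 1) :
    volume ((Set.univ.pi fun _ : Fin n => Ioo (0 : ℝ) 1) \ S) = 0 := by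
  have hcube : volume (unitCube n) = 1 := by simp [unitCube, Real.volume_Icc_pi]
  have h : volume (unitCube n \ S) = 0 := by
    rw [← sdiff_inter_self_eq_sdiff, inter_comm, measure_sdiff inter_subset_left, hcube, hfull,
      tsub_self]
    · exact ((MeasurableSet.univ_pi fun _ => measurableSet_Icc).inter hS).nullMeasurableSet
    · rw [hfull]; exact ENNReal.one_ne_top
  exact measure_mono_null (sdiff_subset_sdiff_left (Set.pi_mono fun _ _ => Ioo_subset_Icc_self)) h

/-- Approximation of a null sequence of radii by powers of two. -/
theorem exists_dyadic_scale {r : ℕ → ℝ} (hrpos : ∀ i, 0 < r i)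
    (hr0 : Tendsto r atTop (nhds 0)) :
    ∃ m : ℕ → ℕ, Tendsto m atTop atTop ∧
      ∀ᶠ i in atTop, r i ≤ (1 / 2 : ℝ) ^ m i ∧ (1 / 2 : ℝ) ^ m i ≤ 2 * r i := by
  have h : ∀ i, ∃ k : ℕ, r i ≤ 1 → (1 / 2 : ℝ) ^ (k + 1) < r i ∧ r i ≤ (1 / 2 : ℝ) ^ k := by
    intro i
    by_cases hi : r i ≤ 1
    · obtain ⟨k, hk⟩ := exists_nat_pow_near_of_lt_one (hrpos i) hi
        (show (0 : ℝ) < 1 / 2 by norm_num) (by norm_num)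
      exact ⟨k, fun _ => hk⟩
    · exact ⟨0, fun h => absurd h hi⟩
  choose m hm using h
  have hev : ∀ᶠ i in atTop, r i < 1 := hr0.eventually (gt_mem_nhds one_pos)
  refine ⟨m, tendsto_atTop.2 fun K => ?_, ?_⟩
  · filter_upwards [hev, hr0.eventually (gt_mem_nhds (show (0 : ℝ) < (1 / 2) ^ K by positivity))]
      with i hi hiK
    have := (hm i hi.le).1.trans hiK
    rw [pow_lt_pow_iff_right_of_lt_one₀ (by norm_num) (by norm_num)] at this
    omega
  · filter_upwards [hev] with i hi
    obtain ⟨h1, h2⟩ := hm i hi.le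
    refine ⟨h2, ?_⟩
    rw [pow_succ] at h1
    linarith

theorem stmt6 (n : ℕ) (hn : 0 < n) (x : ℕ → Fin n → ℝ) (hx : ∀ i, x i ∈ unitCube n)
    (r : ℕ → ℝ) (hrpos : ∀ i, 0 < r i) (hr0 : Tendsto r atTop (nhds 0))
    (a : Fin n → ℝ) (ha : ∀ j, 0 < a j)
    (hfull : volume (unitCube n ∩
        limsup (fun i => Set.univ.pi fun j =>
          Set.Ioo (x i j - r i ^ a j) (x i j + r i ^ a j)) atTop) = 1)
    (γ : ℕ → Fin n → ℝ) (hγbox : ∀ i, x i + γ i ∈ unitCube n)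
    (hγ : ∀ j, ∃ C : ℝ, ∀ᶠ i : ℕ in atTop, |γ i j| ≤ C * r i ^ a j)
    (t : Fin n → ℝ) (ht : ∀ j, 0 ≤ t j) :
    ENNReal.ofReal (mtprrBound n a t) ≤
      dimH (limsup (fun i => Set.univ.pi fun j =>
        Set.Ioo (x i j + γ i j - r i ^ (a j + t j))
          (x i j + γ i j + r i ^ (a j + t j))) atTop) := by
  obtain ⟨m, hm, hmr⟩ := exists_dyadic_scale hrpos hr0
  choose Γ hΓ using hγ
  have hΓ' : ∀ᶠ i in atTop, ∀ j, |γ i j| ≤ Γ j * r i ^ a j := eventually_all.2 hΓ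
  set σ : ℕ → ℝ := fun i => (1 / 2 : ℝ) ^ m i with hσ
  have hσ0 : ∀ i, 0 < σ i := fun i => by positivity
  have hσ1 : ∀ i, σ i ≤ 1 := fun i => pow_le_one₀ (by norm_num) (by norm_num)
  have hat : ∀ j, 0 < a j + t j := fun j => add_pos_of_pos_of_nonneg (ha j) (ht j)
  set C : ℝ := 1 + ∑ j, |Γ j| with hC
  have hC1 : 1 ≤ C := le_add_of_nonneg_right (Finset.sum_nonneg fun j _ => abs_nonneg _)
  set w : ℝ := ∑ j, (a j + t j) with hw
  set c : ℝ := (2 * 2 ^ w)⁻¹ with hc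
  have hc0 : 0 < c := by positivity
  have hw1 : (1 : ℝ) ≤ 2 ^ w :=
    Real.one_le_rpow one_le_two (Finset.sum_nonneg fun j _ => (hat j).le)
  have hc1 : c ≤ 1 := inv_le_one_of_one_le₀ (by linarith)
  set O : Set (Fin n → ℝ) := Set.univ.pi fun _ => Ioo (0 : ℝ) 1 with hO
  have hOo : IsOpen O := isOpen_set_pi Set.finite_univ fun _ _ => isOpen_Ioo
  have hO1 : volume O = 1 := by simp [hO, volume_pi_pi]
  have hRm : ∀ i, MeasurableSet (Set.univ.pi fun j =>
      Set.Ioo (x i j - r i ^ a j) (x i j + r i ^ a j)) :=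
    fun i => MeasurableSet.univ_pi fun _ => measurableSet_Ioo
  have hcov : volume (O \ limsup (fun i => closedBox (x i) fun j => C * σ i ^ a j) atTop) = 0 := by
    refine measure_mono_null (sdiff_subset_sdiff_right ?_) (unitCube_inter_null_of_full
      (MeasurableSet.measurableSet_limsup hRm) hfull)
    refine limsup_le_limsup (hmr.mono fun i hi p hp => mem_closedBox.2 fun j => ?_)
    have h1 := hp j (mem_univ j)
    have h2 : r i ^ a j ≤ σ i ^ a j := Real.rpow_le_rpow (hrpos i).le hi.1 (ha j).le
    have h3 : σ i ^ a j ≤ C * σ i ^ a j :=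
      le_mul_of_one_le_left (Real.rpow_nonneg (hσ0 i).le _) hC1
    rw [abs_le]
    constructor <;> linarith [h1.1, h1.2]
  have hQP : ∀ᶠ i in atTop,
      closedBox (x i + γ i) (fun j => c * σ i ^ (a j + t j)) ⊆
        closedBox (x i) fun j => C * σ i ^ a j := by
    filter_upwards [hmr, hΓ'] with i hi hγi p hp
    refine mem_closedBox.2 fun j => ?_
    have h1 := mem_closedBox.1 hp j
    rw [Pi.add_apply] at h1
    have h2 : r i ^ a j ≤ σ i ^ a j := Real.rpow_le_rpow (hrpos i).le hi.1 (ha j).le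
    have h3 : |γ i j| ≤ (∑ j, |Γ j|) * σ i ^ a j := by
      refine (hγi j).trans (mul_le_mul ?_ h2 (Real.rpow_nonneg (hrpos i).le _)
        (Finset.sum_nonneg fun j _ => abs_nonneg _))
      exact (le_abs_self _).trans
        (Finset.single_le_sum (f := fun j => |Γ j|) (fun _ _ => abs_nonneg _) (Finset.mem_univ j))
    have h4 : c * σ i ^ (a j + t j) ≤ σ i ^ a j :=
      (mul_le_of_le_one_left (Real.rpow_nonneg (hσ0 i).le _) hc1).trans
        (Real.rpow_le_rpow_of_exponent_ge (hσ0 i) (hσ1 i) (by linarith [ht j]))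
    calc |p j - x i j| = |(p j - (x i j + γ i j)) + γ i j| := by congr 1; ring
      _ ≤ c * σ i ^ (a j + t j) + |γ i j| := (abs_add_le _ _).trans (add_le_add_left h1 _)
      _ ≤ C * σ i ^ a j := by rw [hC, add_mul]; linarith
  refine (le_dimH_limsup_closedBox hn ha ht hc0 hc1 (zero_lt_one.trans_le hC1) x
    (fun i => x i + γ i) hm hOo hO1 hcov hQP).trans (dimH_mono ?_)
  refine limsup_le_limsup (hmr.mono fun i hi p hp j _ => ?_)
  have h1 := mem_closedBox.1 hp j
  rw [Pi.add_apply] at h1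
  have h2 : c * σ i ^ (a j + t j) < r i ^ (a j + t j) := by
    have hr : 0 < r i ^ (a j + t j) := Real.rpow_pos_of_pos (hrpos i) _
    rw [hc, inv_mul_lt_iff₀ (by positivity)]
    calc σ i ^ (a j + t j) ≤ (2 * r i) ^ (a j + t j) :=
          Real.rpow_le_rpow (hσ0 i).le hi.2 (hat j).le
      _ = 2 ^ (a j + t j) * r i ^ (a j + t j) := Real.mul_rpow (by norm_num) (hrpos i).le
      _ ≤ 2 ^ w * r i ^ (a j + t j) := by
        gcongr
        · norm_num
        · exact Finset.single_le_sum (fun i _ => (hat i).le) (Finset.mem_univ j)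
      _ < 2 * 2 ^ w * r i ^ (a j + t j) := by
        have : 0 < (2 : ℝ) ^ w * r i ^ (a j + t j) := by positivity
        linarith
  have h3 := abs_lt.1 (h1.trans_lt h2)
  constructor <;> linarith [h3.1, h3.2]
end

section
/- For each j ∈ {1,…,n} let (X_j, d_j) be a bounded metric space and μ_j a Borel probability measure on X_j with support X_j that is δ_j-Ahlfors regular (there are 0 < c₁ ≤ c₂ and r₀ > 0 with c₁ r^{δ_j} ≤ μ_j(B(x,r)) ≤ c₂ r^{δ_j} for all x ∈ X_j, 0 < r < r₀). Let X = ∏_j X_j with d = max_j d_j and μ = ∏_j μ_j. Let (x_i)_{i≥1} be points of X and (r_i)_{i≥1} a sequence of vectors r_i = (r_{i,1},…,r_{i,n}) ∈ ℝ_{>0}^n with max_j r_{i,j} → 0 as i → ∞. Let (U_i)_{i≥1} be sets of the form U_i = ∏_{j=1}^n U_i^{(j)} with each U_i^{(j)} ⊆ X_j μ_j-measurable, such that U_i ⊆ R(x_i, r_i) = ∏_j B(x_{i,j}, r_{i,j}) and there is a constant c > 0 with μ_j( B(x_{i,j}, r_{i,j}) ) ≤ c · μ_j( U_i^{(j)}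 ) for every j ∈ {1,…,n} and every i ∈ ℕ. Then μ( limsup_{i→∞} R(x_i, r_i) ) = μ( limsup_{i→∞} U_i ). -/
open MeasureTheory Filter Set Metric

open scoped ENNReal NNReal Topology

/-- A metric space carrying a finite Borel measure of full support is second countable. -/
theorem secondCountableTopology_of_measure_ball_pos {α : Type*} [PseudoMetricSpace α]
    [MeasurableSpace α] [BorelSpace α] (μ : Measure α) [IsFiniteMeasure μ]
    (hμ : ∀ (x : α) (r : ℝ), 0 < r → 0 < μ (ball x r)) : SecondCountableTopology α := by
  refine Metric.secondCountable_of_almost_dense_set fun ε hε => ?_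
  obtain ⟨u, -, hdisj, hcov⟩ := Vitali.exists_disjoint_subfamily_covering_enlargement_closedBall
    (univ : Set α) id (fun _ => ε / 5) (ε / 5) (fun _ _ => le_rfl) 5 (by norm_num)
  refine ⟨u, ?_, fun x => ?_⟩
  · have hcount := Measure.countable_meas_pos_of_disjoint_iUnion (μ := μ)
      (As := fun a : u => closedBall (a : α) (ε / 5)) (fun _ => measurableSet_closedBall)
      fun a b hab => hdisj a.2 b.2 (Subtype.coe_ne_coe.2 hab)
    have huniv : {a : u | 0 < μ (closedBall (a : α) (ε / 5))} = univ :=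
      eq_univ_of_forall fun a => (hμ a _ (by positivity)).trans_le
        (measure_mono ball_subset_closedBall)
    rw [huniv] at hcount
    exact countable_coe_iff.1 (countable_univ_iff.1 hcount)
  · obtain ⟨b, hb, hsub⟩ := hcov x (mem_univ x)
    refine ⟨b, hb, ?_⟩
    have hx : x ∈ closedBall b (5 * (ε / 5)) := hsub (mem_closedBall_self (by positivity))
    rw [mem_closedBall] at hx
    linarith

/-- An upper and a lower power bound on the measure of small balls bound the measure of a closed
ball of radius `K * r` by the measure of the open ball of radius `r`. -/
theorem exists_measure_closedBall_le_mul_of_ahlfors {α : Type*} [PseudoMetricSpace α]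
    [MeasurableSpace α] (μ : Measure α) {δ c₁ c₂ r₀ : ℝ} (hc₁ : 0 < c₁) (hc : c₁ ≤ c₂)
    (hr₀ : 0 < r₀)
    (h : ∀ (x : α) (r : ℝ), 0 < r → r < r₀ →
      ENNReal.ofReal (c₁ * r ^ δ) ≤ μ (ball x r) ∧ μ (ball x r) ≤ ENNReal.ofReal (c₂ * r ^ δ))
    {K : ℝ} (hK : 0 < K) :
    ∃ C : ℝ≥0, ∀ᶠ r in 𝓝[>] (0 : ℝ), ∀ x, μ (closedBall x (K * r)) ≤ C * μ (ball x r) := by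
  refine ⟨(c₂ * (K + 1) ^ δ / c₁).toNNReal, ?_⟩
  have hpos : 0 < r₀ / (K + 1) := by positivity
  filter_upwards [Ioo_mem_nhdsGT hpos] with r hr x
  have hr1 : (K + 1) * r < r₀ := by
    have := (lt_div_iff₀ (by positivity)).1 hr.2
    linarith
  have hrr : r < r₀ := by nlinarith [hr.1]
  have hr' : 0 < r := hr.1
  calc μ (closedBall x (K * r)) ≤ μ (ball x ((K + 1) * r)) :=
        measure_mono (closedBall_subset_ball (by nlinarith))
    _ ≤ ENNReal.ofReal (c₂ * ((K + 1) * r) ^ δ) := (h x _ (by positivity) hr1).2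
    _ = ENNReal.ofReal (c₂ * (K + 1) ^ δ / c₁) * ENNReal.ofReal (c₁ * r ^ δ) := by
        rw [← ENNReal.ofReal_mul (by have := hc₁.trans_le hc; positivity),
          Real.mul_rpow (by positivity) hr'.le]
        congr 1
        field_simp
    _ ≤ _ := mul_le_mul_right (h x r hr' hrr).1 _

/-- **Cassels' scaling lemma** for sets filling a fixed proportion of shrinking balls, along the
indices satisfying a predicate `p`. -/
theorem measure_frequently_mem_closedBall_and_not_frequently_mem {α : Type*} [PseudoMetricSpace α]
    [SecondCountableTopology α] [MeasurableSpace α] [BorelSpace α] (μ : Measure α)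
    [IsFiniteMeasure μ] [IsUnifLocDoublingMeasure μ] (p : ℕ → Prop) {x : ℕ → α} {r : ℕ → ℝ}
    (hr : Tendsto r atTop (𝓝[>] 0)) {U : ℕ → Set α} (hU : ∀ i, MeasurableSet (U i))
    (hsub : ∀ i, U i ⊆ closedBall (x i) (r i)) (hpos : ∀ i, μ (closedBall (x i) (r i)) ≠ 0)
    {C : ℝ≥0∞} (hC : C ≠ ∞)
    (hbig : ∀ᶠ i in atTop, μ (closedBall (x i) (r i)) ≤ C * μ (U i)) :
    μ {z | (∃ᶠ i in atTop, p i ∧ z ∈ closedBall (x i) (r i)) ∧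
      ¬ ∃ᶠ i in atTop, p i ∧ z ∈ U i} = 0 := by
  set E : ℕ → Set α := fun N =>
    {z | (∃ᶠ i in atTop, p i ∧ z ∈ closedBall (x i) (r i)) ∧ ∀ i ≥ N, p i → z ∉ U i} with hE
  suffices hnull : ∀ N, μ (E N) = 0 by
    refine measure_mono_null (fun z hz => ?_) (measure_iUnion_null hnull)
    obtain ⟨hz₁, hz₂⟩ := hz
    simp only [not_frequently, not_and, eventually_atTop] at hz₂
    obtain ⟨N, hN⟩ := hz₂
    exact mem_iUnion.2 ⟨N, hz₁, hN⟩
  intro N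
  by_contra hne
  obtain ⟨d, hd, hdens⟩ : ∃ d, d ∈ E N ∧ ∀ {ι : Type} {l : Filter ι} (w : ι → α) (δ : ι → ℝ),
      Tendsto δ l (𝓝[>] 0) → (∀ᶠ j in l, d ∈ closedBall (w j) (1 * δ j)) →
        Tendsto (fun j => μ (E N ∩ closedBall (w j) (δ j)) / μ (closedBall (w j) (δ j))) l (𝓝 1) :=
    Measure.exists_mem_of_measure_ne_zero_of_ae hne
      (IsUnifLocDoublingMeasure.ae_tendsto_measure_inter_div μ (E N) 1)
  set l : Filter ℕ := atTop ⊓ 𝓟 {i | p i ∧ d ∈ closedBall (x i) (r i)}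
  have hl : l.NeBot := frequently_mem_iff_neBot.1 hd.1
  have hlat : l ≤ atTop := inf_le_left
  have hlmem : ∀ᶠ i in l, p i ∧ d ∈ closedBall (x i) (r i) :=
    mem_inf_of_right (mem_principal_self _)
  have hlim := hdens x r (hr.mono_left hlat) (by simpa using hlmem.mono fun _ h => h.2)
  have hbound : ∀ᶠ i in l,
      μ (E N ∩ closedBall (x i) (r i)) / μ (closedBall (x i) (r i)) + C⁻¹ ≤ 1 := by
    filter_upwards [hlmem, hlat hbig, hlat (eventually_ge_atTop N)] with i hi hbi hNi
    have hdisj : Disjoint (E N ∩ closedBall (x i) (r i)) (U i) :=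
      disjoint_left.2 fun z hz => hz.1.2 i hNi hi.1
    have hCU : C⁻¹ ≤ μ (U i) / μ (closedBall (x i) (r i)) := by
      rw [ENNReal.le_div_iff_mul_le (.inl (hpos i)) (.inl (measure_ne_top _ _)), mul_comm,
        ← ENNReal.div_eq_inv_mul.trans (mul_comm _ _)]
      exact ENNReal.div_le_of_le_mul' hbi
    calc _ ≤ μ (E N ∩ closedBall (x i) (r i)) / μ (closedBall (x i) (r i)) +
          μ (U i) / μ (closedBall (x i) (r i)) := by gcongr
      _ = μ ((E N ∩ closedBall (x i) (r i)) ∪ U i) / μ (closedBall (x i) (r i)) := by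
          rw [← ENNReal.add_div, measure_union hdisj (hU i)]
      _ ≤ 1 := ENNReal.div_le_of_le_mul <| by
          rw [one_mul]
          exact measure_mono (union_subset inter_subset_right (hsub i))
  have hle : 1 + C⁻¹ ≤ 1 := le_of_tendsto (hlim.add_const _) hbound
  exact (ENNReal.lt_add_right ENNReal.one_ne_top (ENNReal.inv_ne_zero.2 hC)).not_ge hle

/-- A measurable set all of whose sections in one coordinate direction are null is null for the
product measure. -/
theorem measure_pi_eq_zero_of_forall_update {ι : Type*} [Fintype ι] [DecidableEq ι]
    {X : ι → Type*} [∀ j, MeasurableSpace (X j)] (μ : ∀ j, Measure (X j)) [∀ j, SigmaFinite (μ j)]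
    {E : Set (∀ j, X j)} (hE : MeasurableSet E) (j : ι)
    (h : ∀ y, μ j {t | Function.update y j t ∈ E} = 0) : Measure.pi μ E = 0 := by
  rcases isEmpty_or_nonempty (∀ j, X j) with hX | ⟨⟨y₀⟩⟩
  · rw [eq_empty_of_isEmpty E, measure_empty]
  have hf : Measurable (E.indicator (1 : (∀ j, X j) → ℝ≥0∞)) := measurable_one.indicator hE
  rw [← lintegral_indicator_one hE, lintegral_eq_lmarginal_univ y₀,
    lmarginal_erase' _ hf (Finset.mem_univ j)]
  have hzero : (fun y => ∫⁻ t, E.indicator (1 : (∀ j, X j) → ℝ≥0∞) (Function.update y j t) ∂μ j) =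
      0 := by
    ext y
    exact (lintegral_indicator_one (measurable_update y hE)).trans (h y)
  rw [hzero]
  simp [lmarginal]

theorem update_mem_univ_pi_iff {ι : Type*} [DecidableEq ι] {X : ι → Type*} (V : ∀ j, Set (X j))
    (y : ∀ j, X j) (j : ι) (t : X j) :
    Function.update y j t ∈ univ.pi V ↔ (∀ k ≠ j, y k ∈ V k) ∧ t ∈ V j := by
  rw [mem_univ_pi, Function.forall_update_iff y fun k a => a ∈ V k, and_comm]

theorem stmt7 (n : ℕ) (X : Fin n → Type*) [∀ j, MetricSpace (X j)]
    [∀ j, MeasurableSpace (X j)] [∀ j, BorelSpace (X j)]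
    (hbdd : ∀ j, Bornology.IsBounded (Set.univ : Set (X j)))
    (μ : ∀ j, Measure (X j)) [∀ j, IsProbabilityMeasure (μ j)]
    (δ : Fin n → ℝ) (hδ : ∀ j, 0 < δ j)
    (hAhlfors : ∀ j, ∃ c₁ c₂ r₀ : ℝ, 0 < c₁ ∧ c₁ ≤ c₂ ∧ 0 < r₀ ∧
      ∀ (x : X j) (r : ℝ), 0 < r → r < r₀ →
        ENNReal.ofReal (c₁ * r ^ δ j) ≤ μ j (ball x r) ∧
          μ j (ball x r) ≤ ENNReal.ofReal (c₂ * r ^ δ j))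
    (hsupp : ∀ j (x : X j) (r : ℝ), 0 < r → 0 < μ j (ball x r))
    (x : ℕ → ∀ j, X j) (r : ℕ → Fin n → ℝ) (hrpos : ∀ i j, 0 < r i j)
    (hr0 : ∀ j, Tendsto (fun i => r i j) atTop (nhds 0))
    (U : ℕ → ∀ j, Set (X j)) (hUmeas : ∀ i j, MeasurableSet (U i j))
    (hUsub : ∀ i, Set.univ.pi (U i) ⊆ Set.univ.pi fun j => ball (x i j) (r i j))
    (c : ℝ) (hc : 0 < c)
    (hUbig : ∀ i j, μ j (ball (x i j) (r i j)) ≤ ENNReal.ofReal c * μ j (U i j)) :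
    Measure.pi μ (limsup (fun i => Set.univ.pi fun j => ball (x i j) (r i j)) atTop) =
      Measure.pi μ (limsup (fun i => Set.univ.pi (U i)) atTop) := by
  have hUne : ∀ i, (univ.pi (U i)).Nonempty := fun i => univ_pi_nonempty_iff.2 fun j =>
    nonempty_of_measure_ne_zero (μ := μ j) fun h0 =>
      (hsupp j (x i j) (r i j) (hrpos i j)).not_ge (by simpa [h0] using hUbig i j)
  have hUball : ∀ i j, U i j ⊆ ball (x i j) (r i j) := fun i j => by
    have h := image_mono (f := Function.eval j) (hUsub i)
    rw [eval_image_univ_pi (hUne i)] at h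
    exact h.trans eval_image_univ_pi_subset
  have hnull : ∀ (j : Fin n) (p : ℕ → Prop), μ j
      {z | (∃ᶠ i in atTop, p i ∧ z ∈ ball (x i j) (r i j)) ∧
        ¬ ∃ᶠ i in atTop, p i ∧ z ∈ U i j} = 0 := by
    intro j p
    obtain ⟨c₁, c₂, r₀, hc₁, hc₁₂, hr₀, hA⟩ := hAhlfors j
    have := secondCountableTopology_of_measure_ball_pos (μ j) (hsupp j)
    have : IsUnifLocDoublingMeasure (μ j) := by
      obtain ⟨C, hC⟩ := exists_measure_closedBall_le_mul_of_ahlfors (μ j) hc₁ hc₁₂ hr₀ hA two_pos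
      exact ⟨C, hC.mono fun ε h y => (h y).trans
        (mul_le_mul_right (measure_mono ball_subset_closedBall) _)⟩
    obtain ⟨C, hC⟩ := exists_measure_closedBall_le_mul_of_ahlfors (μ j) hc₁ hc₁₂ hr₀ hA one_pos
    have hr : Tendsto (fun i => r i j) atTop (𝓝[>] 0) :=
      tendsto_nhdsWithin_iff.2 ⟨hr0 j, .of_forall fun i => hrpos i j⟩
    refine measure_mono_null (fun z hz => And.imp_left
      (fun h => h.mono fun i hi => And.imp_right (ball_subset_closedBall ·) hi) hz)
      (measure_frequently_mem_closedBall_and_not_frequently_mem (μ j) p hr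
        (fun i => hUmeas i j) (fun i => (hUball i j).trans ball_subset_closedBall)
        (fun i => ((hsupp j _ _ (hrpos i j)).trans_le (measure_mono ball_subset_closedBall)).ne')
        (C := C * ENNReal.ofReal c) (by finiteness) ?_)
    filter_upwards [hr.eventually hC] with i hi
    rw [mul_assoc, ← one_mul (r i j)]
    exact (hi (x i j)).trans (mul_le_mul_right (by simpa using hUbig i j) _)
  let V : Finset (Fin n) → ℕ → ∀ j, Set (X j) := fun s i j =>
    if j ∈ s then U i j else ball (x i j) (r i j)
  let L : Finset (Fin n) → Set (∀ j, X j) := fun s => limsup (fun i => univ.pi (V s i)) atTop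
  have hLmeas : ∀ s, MeasurableSet (L s) := fun s =>
    MeasurableSet.measurableSet_limsup fun i => MeasurableSet.univ_pi fun j => by
      by_cases hj : j ∈ s
      · simpa [V, hj] using hUmeas i j
      · simpa [V, hj] using measurableSet_ball
  have hle : ∀ s, L ∅ ≤ᵐ[Measure.pi μ] L s := by
    intro s
    induction s using Finset.induction_on with
    | empty => exact EventuallyLE.refl _ _
    | insert j s hj ih =>
      refine ih.trans (ae_le_set.2 ?_)
      refine measure_pi_eq_zero_of_forall_update μ ((hLmeas s).diff (hLmeas _)) j fun y => ?_
      refine measure_mono_null (fun t ht => ?_) (hnull j fun i => ∀ k ≠ j, y k ∈ V s i k)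
      have hk : ∀ i, (∀ k ≠ j, y k ∈ V (insert j s) i k) ↔ ∀ k ≠ j, y k ∈ V s i k := fun i =>
        forall₂_congr fun k hkj => by simp [V, hkj]
      have hjs : ∀ i, V s i j = ball (x i j) (r i j) := fun i => by simp [V, hj]
      have hji : ∀ i, V (insert j s) i j = U i j := fun i => by simp [V]
      simpa only [L, mem_ofPred_eq, Set.mem_sdiff, mem_limsup_iff_frequently_mem,
        update_mem_univ_pi_iff, hk, hjs, hji] using ht
  refine le_antisymm ?_ (measure_mono (limsup_le_limsup (.of_forall hUsub)))
  have hL₀ : L ∅ = limsup (fun i => univ.pi fun j => ball (x i j) (r i j)) atTop := by simp [L, V]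
  have hL₁ : L Finset.univ = limsup (fun i => univ.pi (U i)) atTop := by simp [L, V]
  rw [← hL₀, ← hL₁]
  exact measure_mono_ae (hle Finset.univ)
end

section
/- Let n ≥ 2, let ψ(q) = q^{-τ_ψ} with 1/n ≤ τ_ψ ≤ 2/(n-1), and let φ(q) = q^{-τ_φ} with τ_φ > 0. Then dim_H W_n(ψ,φ) = (n + 1 + (n-1)τ_φ)/(1 + τ_ψ + τ_φ). -/
open MeasureTheory Filter Set

/-- `W_n(ψ, φ)`: the set of `x ∈ [0,1]^n` such that
`(1-φ(q))·ψ(q)/q < ‖x - p/q‖ < ψ(q)/q` for infinitely many pairs `(p,q) ∈ ℤ^n × ℕ`. -/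
def Wpsiphi (n : ℕ) (ψ φ : ℕ → ℝ) : Set (Fin n → ℝ) :=
  {x ∈ unitCube n |
    {pq : (Fin n → ℤ) × ℕ | 0 < pq.2 ∧
      (1 - φ pq.2) * (ψ pq.2 / pq.2) < ‖x - fun i => (pq.1 i : ℝ) / pq.2‖ ∧
      ‖x - fun i => (pq.1 i : ℝ) / pq.2‖ < ψ pq.2 / pq.2}.Infinite}

section Hausdorff

open Metric Topology ENNReal NNReal

/-- **Hausdorff–Cantelli lemma**. -/
theorem hausdorffMeasure_setOf_infinite_eq_zero {X ι : Type*} [MetricSpace X] [MeasurableSpace X]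
    [BorelSpace X] [Countable ι] {d : ℝ} (hd : 0 < d) (U : ι → Set X)
    (hU : ∑' i, ediam (U i) ^ d ≠ ∞) :
    μH[d] {x | {i | x ∈ U i}.Infinite} = 0 := by
  have htail := ENNReal.tendsto_tsum_compl_atTop_zero hU
  have hle := Measure.hausdorffMeasure_le_liminf_tsum (X := X) (β := Finset ι)
    (ι := fun F => {i // i ∉ F}) d {x | {i | x ∈ U i}.Infinite} (l := atTop)
    (fun F => (∑' i : {i // i ∉ F}, ediam (U i) ^ d) ^ (1 / d)) (by
      have h := (ENNReal.continuous_rpow_const (y := 1 / d)).tendsto 0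
      rw [ENNReal.zero_rpow_of_pos (by positivity)] at h
      exact h.comp htail)
    (fun F i => U i) (by
      refine Eventually.of_forall fun F i => ?_
      have h : ediam (U i) ^ d ≤ ∑' i : {i // i ∉ F}, ediam (U i) ^ d :=
        ENNReal.le_tsum (f := fun i : {i // i ∉ F} => ediam (U i) ^ d) i
      calc ediam (U i) = (ediam (U i) ^ d) ^ (1 / d) := by
            rw [← ENNReal.rpow_mul, mul_one_div_cancel hd.ne', ENNReal.rpow_one]
        _ ≤ _ := ENNReal.rpow_le_rpow h (by positivity))
    (by
      refine Eventually.of_forall fun F x hx => ?_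
      obtain ⟨i, hi, hiF⟩ := Set.Infinite.exists_notMem_finset hx F
      exact mem_iUnion.2 ⟨⟨i, hiF⟩, hi⟩)
  rw [htail.liminf_eq] at hle
  exact le_antisymm hle zero_le

/-- A form of the **mass distribution principle** for a decreasing sequence of compact sets. -/
theorem hausdorffMeasure_iInter_ne_zero {X : Type*} [MetricSpace X] [MeasurableSpace X]
    [BorelSpace X] {K : ℕ → Set X} (hK : ∀ j, IsCompact (K j)) (hanti : Antitone K)
    (ν : ℕ → Measure X) {c C : ℝ≥0∞} {t : ℝ} (ht : 0 < t) (hc : c ≠ 0) (hC : C ≠ ∞)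
    (hν : ∀ j, c ≤ ν j (K j))
    (hball : ∀ j x r, 0 < r → ν j (closedBall x r) ≤ C * ENNReal.ofReal (r ^ t)) :
    μH[t] (⋂ j, K j) ≠ 0 := by
  intro h0
  obtain ⟨ε, hε, hεC⟩ : ∃ ε : ℝ≥0∞, ε ≠ 0 ∧ C * (ε + ε) < c := by
    have : Tendsto (fun ε : ℝ≥0∞ => C * (ε + ε)) (𝓝[>] 0) (𝓝 (C * (0 + 0))) := by
      refine Tendsto.mono_left ?_ nhdsWithin_le_nhds
      exact ENNReal.Tendsto.const_mul (tendsto_id.add tendsto_id) (Or.inr hC)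
    rw [add_zero, mul_zero] at this
    obtain ⟨ε, h1, h2⟩ := ((this.eventually_lt_const (pos_iff_ne_zero.2 hc)).and
      self_mem_nhdsWithin).exists
    exact ⟨ε, (mem_Ioi.1 h2).ne', h1⟩
  rw [Measure.hausdorffMeasure_apply] at h0
  have h1 : (⨅ (u : ℕ → Set X) (_ : ⋂ j, K j ⊆ ⋃ n, u n) (_ : ∀ n, ediam (u n) ≤ 1),
      ∑' n, ⨆ _ : (u n).Nonempty, ediam (u n) ^ t) < ε := by
    refine lt_of_le_of_lt ?_ (pos_iff_ne_zero.2 hε)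
    rw [← h0]
    exact le_iSup₂ (f := fun (r : ℝ≥0∞) (_ : 0 < r) => ⨅ (u : ℕ → Set X)
      (_ : ⋂ j, K j ⊆ ⋃ n, u n) (_ : ∀ n, ediam (u n) ≤ r),
      ∑' n, ⨆ _ : (u n).Nonempty, ediam (u n) ^ t) 1 one_pos
  simp only [iInf_lt_iff] at h1
  obtain ⟨u, hcov, hdiam, hsum⟩ := h1
  obtain ⟨δ, hδ, hδsum⟩ := ENNReal.exists_pos_sum_of_countable' hε ℕ
  have hV : ∀ n, ∃ V : Set X, IsOpen V ∧ u n ⊆ V ∧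
      ∀ j, ν j V ≤ C * ((⨆ _ : (u n).Nonempty, ediam (u n) ^ t) + δ n) := by
    intro n
    rcases (u n).eq_empty_or_nonempty with he | ⟨x, hx⟩
    · exact ⟨∅, isOpen_empty, he.subset, fun j => by simp⟩
    have hfin : ediam (u n) ≠ ∞ := ((hdiam n).trans_lt one_lt_top).ne
    have hcont : Tendsto (fun r : ℝ => ENNReal.ofReal (r ^ t)) (𝓝[>] (ediam (u n)).toReal)
        (𝓝 (ENNReal.ofReal ((ediam (u n)).toReal ^ t))) := by
      refine Tendsto.mono_left ?_ nhdsWithin_le_nhds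
      exact (ENNReal.continuous_ofReal.comp (Real.continuous_rpow_const ht.le)).tendsto _
    rw [← ENNReal.ofReal_rpow_of_nonneg toReal_nonneg ht.le, ofReal_toReal hfin] at hcont
    have hlt : ediam (u n) ^ t < ediam (u n) ^ t + δ n :=
      ENNReal.lt_add_right (ENNReal.rpow_ne_top_of_nonneg ht.le hfin) (hδ n).ne'
    obtain ⟨r, hr1, hr2⟩ := ((hcont.eventually_lt_const hlt).and self_mem_nhdsWithin).exists
    have hr2' : (ediam (u n)).toReal < r := hr2
    have hr0 : 0 < r := toReal_nonneg.trans_lt hr2'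
    refine ⟨ball x r, isOpen_ball, fun y hy => ?_, fun j => ?_⟩
    · rw [mem_ball, dist_edist]
      exact (ENNReal.toReal_mono hfin (edist_le_ediam_of_mem hy hx)).trans_lt hr2'
    · rw [iSup_pos ⟨x, hx⟩]
      exact (measure_mono ball_subset_closedBall).trans ((hball j x r hr0).trans (by gcongr))
  choose V hVo huV hVν using hV
  obtain ⟨j, hj⟩ : ∃ j, K j ⊆ ⋃ n, V n :=
    exists_subset_nhds_of_isCompact hanti.directed_ge hK (U := ⋃ n, V n) fun x hx =>
      (isOpen_iUnion hVo).mem_nhds (iUnion_mono huV (hcov hx))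
  have : c ≤ C * (ε + ε) := calc
    c ≤ ν j (⋃ n, V n) := (hν j).trans (measure_mono hj)
    _ ≤ ∑' n, ν j (V n) := measure_iUnion_le _
    _ ≤ ∑' n, C * ((⨆ _ : (u n).Nonempty, ediam (u n) ^ t) + δ n) :=
        ENNReal.tsum_le_tsum fun n => hVν n j
    _ = C * ((∑' n, ⨆ _ : (u n).Nonempty, ediam (u n) ^ t) + ∑' n, δ n) := by
        rw [ENNReal.tsum_mul_left, ENNReal.tsum_add]
    _ ≤ C * (ε + ε) := by gcongr
  exact absurd hεC this.not_gt

end Hausdorff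

section Redistribution

open Metric Topology ENNReal NNReal

/-- A finite family of measurable sets can be shrunk to a disjoint one with the same union. -/
theorem exists_pairwiseDisjoint_refinement {X ι : Type*} [MeasurableSpace X] (I : Finset ι)
    (B : ι → Set X) (hB : ∀ i, MeasurableSet (B i)) :
    ∃ V : ι → Set X, (∀ i, MeasurableSet (V i)) ∧ (∀ i, V i ⊆ B i) ∧
      (I : Set ι).PairwiseDisjoint V ∧ ⋃ i ∈ I, V i = ⋃ i ∈ I, B i := by
  classical
  induction I using Finset.induction_on with
  | empty => exact ⟨B, hB, fun i => subset_rfl, by simp, rfl⟩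
  | insert a I ha ih =>
    obtain ⟨V, hVm, hVB, hVd, hVU⟩ := ih
    have hne : ∀ i ∈ I, i ≠ a := fun i hi h => ha (h ▸ hi)
    refine ⟨fun i => if i = a then B a \ ⋃ j ∈ I, V j else V i, fun i => ?_, fun i => ?_, ?_, ?_⟩
    · dsimp only
      split_ifs
      · exact (hB a).diff (I.measurableSet_biUnion fun j _ => hVm j)
      · exact hVm i
    · dsimp only
      split_ifs with h
      · exact h ▸ sdiff_subset
      · exact hVB i
    · rw [Finset.coe_insert, pairwiseDisjoint_insert_of_notMem (by simpa using ha)]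
      refine ⟨fun i hi j hj hij => ?_, fun j hj => ?_⟩
      · simp only [Function.onFun, hne i hi, hne j hj, if_false]
        exact hVd hi hj hij
      · simp only [hne j hj, if_false, if_true]
        exact disjoint_left.2 fun x hx hxj => hx.2 (mem_biUnion hj hxj)
    · rw [Finset.set_biUnion_insert, Finset.set_biUnion_insert, ← hVU, if_pos rfl]
      have : ⋃ x ∈ I, (if x = a then B a \ ⋃ j ∈ I, V j else V x) = ⋃ x ∈ I, V x :=
        iUnion₂_congr fun i hi => if_neg (hne i hi)
      rw [this, sdiff_union_self]

/-- Redistribution of a measure `μ`: the mass of (a part of) each `B i` is spread according to the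
probability measure `σ i` carried by `R i`, nothing being moved by more than `ρ`. -/
theorem exists_redistribution {X ι : Type*} [PseudoMetricSpace X] [MeasurableSpace X]
    [BorelSpace X] (μ vol : Measure X) [IsFiniteMeasure μ] {S : Set X} (hS : μ Sᶜ = 0)
    (I : Finset ι) (B R : ι → Set X) (σ : ι → Measure X) (hB : ∀ i, MeasurableSet (B i))
    (hR : ∀ i, IsCompact (R i)) (hσ : ∀ i ∈ I, σ i univ = 1) (hσR : ∀ i ∈ I, σ i (R i)ᶜ = 0)
    (D : ι → ℝ≥0) (hσD : ∀ i ∈ I, σ i ≤ D i • vol) {ρ : ℝ}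
    (hρ : ∀ i ∈ I, ∀ x ∈ B i, ∀ y ∈ R i, dist y x ≤ ρ) :
    ∃ (μ' : Measure X) (S' : Set X), IsCompact S' ∧ μ' S'ᶜ = 0 ∧ S' ⊆ ⋃ i ∈ I, R i ∧
      S' ⊆ cthickening ρ S ∧ (∃ M : ℝ≥0, μ' ≤ M • vol) ∧ μ (⋃ i ∈ I, B i) ≤ μ' univ ∧
      ∀ x r g, (∀ i ∈ I, σ i (closedBall x r) ≤ g) →
        μ' (closedBall x r) ≤ g * μ (closedBall x (r + ρ)) := by
  classical
  obtain ⟨V, hVm, hVB, hVd, hVU⟩ := exists_pairwiseDisjoint_refinement I B hB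
  set J : Finset ι := {i ∈ I | μ (V i) ≠ 0} with hJ
  have hJI : ∀ i ∈ J, i ∈ I := fun i hi => (Finset.mem_filter.1 hi).1
  set μ' : Measure X := ∑ i ∈ J, μ (V i) • σ i with hμ'
  have happ : ∀ A, μ' A = ∑ i ∈ J, μ (V i) * σ i A := fun A => by
    simp [hμ', Measure.finsetSum_apply]
  refine ⟨μ', ⋃ i ∈ J, R i, J.isCompact_biUnion fun i _ => hR i, ?_, ?_, ?_, ?_, ?_, ?_⟩
  · rw [happ]
    refine Finset.sum_eq_zero fun i hi => ?_
    have hsub := subset_iUnion₂ (s := fun i (_ : i ∈ J) => R i) i hi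
    rw [measure_mono_null (compl_subset_compl.2 hsub) (hσR i (hJI i hi)), mul_zero]
  · exact biUnion_subset_biUnion_left fun i hi => hJI i hi
  · refine iUnion₂_subset fun i hi y hy => ?_
    have h0 : μ (V i ∩ S) ≠ 0 := by
      rw [measure_inter_conull hS]
      exact (Finset.mem_filter.1 hi).2
    obtain ⟨x, hxV, hxS⟩ := nonempty_of_measure_ne_zero h0
    exact mem_cthickening_of_dist_le y x ρ S hxS (hρ i (hJI i hi) x (hVB i hxV) y hy)
  · refine ⟨∑ i ∈ J, (μ (V i)).toNNReal * D i, fun A => ?_⟩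
    rw [happ, Measure.smul_apply, Finset.sum_smul]
    refine Finset.sum_le_sum fun i hi => ?_
    rw [mul_smul, ENNReal.smul_def, ENNReal.coe_toNNReal (measure_ne_top _ _), smul_eq_mul]
    gcongr
    exact hσD i (hJI i hi) A
  · rw [← hVU, happ]
    refine (measure_biUnion_finset_le _ _).trans (le_of_eq ?_)
    rw [hJ, Finset.sum_filter]
    refine Finset.sum_congr rfl fun i hi => ?_
    split_ifs with h
    · rw [hσ i hi, mul_one]
    · exact not_not.1 h
  · intro x r g hg
    rw [happ]
    set T : Finset ι := {i ∈ J | σ i (closedBall x r) ≠ 0} with hT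
    have hTI : ∀ i ∈ T, i ∈ I := fun i hi => hJI i (Finset.mem_filter.1 hi).1
    calc ∑ i ∈ J, μ (V i) * σ i (closedBall x r)
        = ∑ i ∈ T, μ (V i) * σ i (closedBall x r) := by
          refine (Finset.sum_filter_of_ne fun i _ h => ?_).symm
          exact right_ne_zero_of_mul h
      _ ≤ ∑ i ∈ T, μ (V i) * g := by
          gcongr with i hi
          exact hg i (hTI i hi)
      _ = g * μ (⋃ i ∈ T, V i) := by
          rw [measure_biUnion_finset (hVd.subset fun i hi => hTI i hi) fun i _ => hVm i,
            ← Finset.sum_mul, mul_comm]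
      _ ≤ g * μ (closedBall x (r + ρ)) := by
          gcongr
          refine iUnion₂_subset fun i hi z hz => ?_
          have h0 : σ i (closedBall x r ∩ R i) ≠ 0 := by
            rw [measure_inter_conull (hσR i (hTI i hi))]
            exact (Finset.mem_filter.1 hi).2
          obtain ⟨y, hyx, hyR⟩ := nonempty_of_measure_ne_zero h0
          have h1 := hρ i (hTI i hi) z (hVB i hz) y hyR
          rw [mem_closedBall] at hyx ⊢
          rw [dist_comm] at h1
          linarith [dist_triangle z y x]

end Redistribution

section Growth

open Metric Topology ENNReal NNReal

theorem eventually_mul_rpow_le_one (A : ℝ) {a : ℝ} (ha : 0 < a) :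
    ∀ᶠ r : ℝ in 𝓝[>] 0, A * r ^ a ≤ 1 := by
  have h : Tendsto (fun r : ℝ => A * r ^ a) (𝓝[>] 0) (𝓝 (A * 0 ^ a)) :=
    (((Real.continuous_rpow_const ha.le).const_mul A).tendsto 0).mono_left nhdsWithin_le_nhds
  rw [Real.zero_rpow ha.ne', mul_zero] at h
  exact h.eventually_le_const one_pos

theorem measure_closedBall_le_of_le_smul_volume {ι : Type*} [Fintype ι] {μ : Measure (ι → ℝ)}
    {M : ℝ≥0} (hM : μ ≤ M • volume) (x : ι → ℝ) {r : ℝ} (hr : 0 ≤ r) :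
    μ (closedBall x r) ≤ ENNReal.ofReal (M * (2 * r) ^ Fintype.card ι) := by
  refine (hM _).trans (le_of_eq ?_)
  rw [Measure.smul_apply, Real.volume_pi_closedBall x hr, ENNReal.smul_def, smul_eq_mul,
    ENNReal.ofReal_mul M.coe_nonneg, ENNReal.ofReal_coe_nnreal]

/-- The growth of a measure of bounded density is almost not affected by a redistribution at a
sufficiently small scale `ρ` along probability measures whose growth is controlled by
`C * ρ ^ (-n) * r ^ s`. -/
theorem eventually_redistribution_growth_le {n : ℕ} {μ : Measure (Fin n → ℝ)} {M : ℝ≥0}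
    (hM : μ ≤ M • volume) {H H' s t C : ℝ} (hH : 1 ≤ H) (hHH' : H < H') (ht : 0 ≤ t)
    (hts : t < s) (hsn : s ≤ n) (hC : 0 ≤ C)
    (hμ : ∀ x r, 0 < r → μ (closedBall x r) ≤ ENNReal.ofReal (H * r ^ t)) :
    ∀ᶠ ρ : ℝ in 𝓝[>] 0, ∀ x r, 0 < r →
      min 1 (ENNReal.ofReal (C * (ρ ^ n)⁻¹ * r ^ s)) * μ (closedBall x (r + ρ)) ≤
        ENNReal.ofReal (H' * r ^ t) := by
  have hH0 : 0 < H := one_pos.trans_le hH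
  have hH' : 1 ≤ H' := hH.trans hHH'.le
  have hpos : ∀ᶠ r : ℝ in 𝓝[>] 0, 0 < r := self_mem_nhdsWithin
  obtain ⟨κ, hκ0, hκ⟩ :=
    (hpos.and (eventually_mul_rpow_le_one (M * 4 ^ n) (sub_pos.2 (hts.trans_le hsn)))).exists
  have hlim : ∀ᶠ ρ : ℝ in 𝓝[>] 0, H * (1 + ρ / κ) ^ t < H' := by
    have hc : Continuous fun ρ : ℝ => H * (1 + ρ / κ) ^ t :=
      ((Real.continuous_rpow_const ht).comp (by fun_prop)).const_mul H
    have h := (hc.tendsto 0).mono_left (nhdsWithin_le_nhds (s := Ioi 0))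
    refine h.eventually_lt_const ?_
    simpa using hHH'
  filter_upwards [hpos, hlim, eventually_mul_rpow_le_one (C * M * 4 ^ n) (sub_pos.2 hts)]
    with ρ hρ0 hρκ hρ x r hr
  have hrt : 0 < r ^ t := Real.rpow_pos_of_pos hr t
  have hball : μ (closedBall x (r + ρ)) ≤ ENNReal.ofReal (M * (2 * (r + ρ)) ^ n) := by
    simpa using measure_closedBall_le_of_le_smul_volume hM x (add_pos hr hρ0).le
  have hball' : min 1 (ENNReal.ofReal (C * (ρ ^ n)⁻¹ * r ^ s)) * μ (closedBall x (r + ρ)) ≤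
      μ (closedBall x (r + ρ)) := mul_le_of_le_one_left' (min_le_left _ _)
  rcases lt_or_ge r ρ with hrρ | hrρ
  · refine (mul_le_mul' (min_le_right _ _) hball).trans ?_
    rw [← ENNReal.ofReal_mul (by positivity)]
    refine ENNReal.ofReal_le_ofReal ?_
    calc C * (ρ ^ n)⁻¹ * r ^ s * (M * (2 * (r + ρ)) ^ n)
        ≤ C * (ρ ^ n)⁻¹ * r ^ s * (M * (4 * ρ) ^ n) := by
          have h : 2 * (r + ρ) ≤ 4 * ρ := by linarith
          gcongr _ * (_ * ?_ ^ n)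
      _ = C * M * 4 ^ n * r ^ (s - t) * r ^ t := by
          rw [mul_assoc _ (r ^ (s - t)), ← Real.rpow_add hr, sub_add_cancel, mul_pow]
          field_simp
      _ ≤ C * M * 4 ^ n * ρ ^ (s - t) * r ^ t := by
          have := sub_pos.2 hts
          gcongr
      _ ≤ 1 * r ^ t := by gcongr
      _ ≤ H' * r ^ t := by gcongr
  rcases le_or_gt r κ with hrκ | hrκ
  · refine hball'.trans (hball.trans (ENNReal.ofReal_le_ofReal ?_))
    calc M * (2 * (r + ρ)) ^ n ≤ M * (4 * r) ^ n := by
          have h : 2 * (r + ρ) ≤ 4 * r := by linarith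
          gcongr _ * ?_ ^ n
      _ = M * 4 ^ n * r ^ ((n : ℝ) - t) * r ^ t := by
          rw [mul_assoc _ (r ^ _), ← Real.rpow_add hr, sub_add_cancel, mul_pow, Real.rpow_natCast,
            mul_assoc]
      _ ≤ M * 4 ^ n * κ ^ ((n : ℝ) - t) * r ^ t := by
          have := sub_pos.2 (hts.trans_le hsn)
          gcongr
      _ ≤ 1 * r ^ t := by gcongr
      _ ≤ H' * r ^ t := by gcongr
  · refine hball'.trans ((hμ x _ (add_pos hr hρ0)).trans (ENNReal.ofReal_le_ofReal ?_))
    calc H * (r + ρ) ^ t ≤ H * ((1 + ρ / κ) * r) ^ t := by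
          gcongr
          have : ρ ≤ ρ / κ * r := by
            rw [div_mul_eq_mul_div, le_div_iff₀ hκ0]
            gcongr
          linarith
      _ = H * (1 + ρ / κ) ^ t * r ^ t := by
          rw [Real.mul_rpow (by positivity) hr.le, mul_assoc]
      _ ≤ H' * r ^ t := by gcongr

end Growth

section Dirichlet

open Metric Topology ENNReal NNReal

/-- **Dirichlet's theorem** on simultaneous approximation. -/
theorem exists_simultaneous_approx {n : ℕ} (x : Fin n → ℝ) {N : ℕ} (hN : 0 < N) :
    ∃ q : ℕ, 0 < q ∧ q ≤ N ^ n ∧ ∃ p : Fin n → ℤ, ∀ i, |q * x i - p i| ≤ 1 / N := by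
  have hN' : (0 : ℝ) < N := by exact_mod_cast hN
  set f : ℕ → Fin n → ℕ := fun k i => ⌊N * Int.fract (k * x i)⌋₊ with hf
  obtain ⟨k, hk, l, hl, hkl, hfkl⟩ := Finset.exists_ne_map_eq_of_card_lt_of_maps_to
    (s := Finset.range (N ^ n + 1)) (t := Fintype.piFinset fun _ : Fin n => Finset.range N)
    (f := f) (by simp) (by
      intro k _
      rw [Finset.mem_coe, Fintype.mem_piFinset]
      intro i
      rw [Finset.mem_range, hf, Nat.floor_lt (by positivity)]
      exact mul_lt_of_lt_one_right hN' (Int.fract_lt_one _))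
  wlog hlt : l < k generalizing k l
  · exact this l hl k hk hkl.symm hfkl.symm (lt_of_le_of_ne (not_lt.1 hlt) hkl)
  rw [Finset.mem_range] at hk
  refine ⟨k - l, by omega, by omega, fun i => ⌊k * x i⌋ - ⌊l * x i⌋, fun i => ?_⟩
  have h1 := congrFun hfkl i
  simp only [hf] at h1
  have ha := Nat.floor_le (a := N * Int.fract (k * x i)) (by positivity)
  have hb := Nat.lt_floor_add_one (N * Int.fract (k * x i))
  have hc := Nat.floor_le (a := N * Int.fract (l * x i)) (by positivity)
  have hd := Nat.lt_floor_add_one (N * Int.fract (l * x i))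
  rw [h1] at ha hb
  rw [Nat.cast_sub hlt.le, le_div_iff₀' hN', ← Nat.abs_cast N, ← abs_mul, abs_le]
  push_cast
  have e : N * ((k - l) * x i - (⌊k * x i⌋ - ⌊l * x i⌋) : ℝ) =
      N * Int.fract (k * x i) - N * Int.fract (l * x i) := by
    rw [← Int.self_sub_floor, ← Int.self_sub_floor]
    ring
  rw [e]
  constructor <;> linarith

end Dirichlet

section BadSet

open Metric Topology ENNReal NNReal

/-- The point `p / q`. -/
noncomputable def ratPoint {n : ℕ} (p : Fin n → ℤ) (q : ℕ) : Fin n → ℝ := fun i => (p i : ℝ) / q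

/-- Indices of the rational points `p / q` near the unit cube with `L < q ≤ N ^ n`. -/
noncomputable def approxIndex (n L N : ℕ) : Finset ((Fin n → ℤ) × ℕ) :=
  (Fintype.piFinset fun _ => Finset.Icc (-1) ((N ^ n : ℕ) + 1 : ℤ)) ×ˢ Finset.Ioc L (N ^ n)

theorem mem_closedBall_ratPoint {n : ℕ} {x : Fin n → ℝ} {p : Fin n → ℤ} {q N : ℕ} (hq : 0 < q)
    (h : ∀ i, |q * x i - p i| ≤ 1 / N) : x ∈ closedBall (ratPoint p q) (1 / (q * N)) := by
  have hq' : (0 : ℝ) < q := by exact_mod_cast hq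
  rw [mem_closedBall, dist_pi_le_iff (by positivity)]
  intro i
  have e : x i - p i / q = (q * x i - p i) / q := by field_simp
  rw [Real.dist_eq, ratPoint, e, abs_div, abs_of_pos hq', div_le_iff₀ hq']
  refine (h i).trans (le_of_eq ?_)
  field_simp

/-- The points of the unit cube which are not well approximated by rational points with
denominator greater than `L` have small volume. -/
theorem volume_unitCube_diff_le (n L : ℕ) {N : ℕ} (hN : 0 < N) :
    volume (unitCube n \ ⋃ i ∈ approxIndex n L N,
      closedBall (ratPoint i.1 i.2) (1 / (i.2 * N))) ≤ ENNReal.ofReal (L * (8 / N) ^ n) := by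
  have hN' : (1 : ℝ) ≤ N := by exact_mod_cast hN
  have hN1 : (1 : ℝ) / N ≤ 1 := by rw [div_le_one (by linarith)]; exact hN'
  have hsub : unitCube n \ ⋃ i ∈ approxIndex n L N,
      closedBall (ratPoint i.1 i.2) (1 / (i.2 * N)) ⊆
      ⋃ q ∈ Finset.Icc 1 L, ⋃ p ∈ Fintype.piFinset fun _ : Fin n => Finset.Icc (-1) (q + 1 : ℤ),
        closedBall (ratPoint p q) (1 / (q * N)) := by
    rintro x ⟨hx, hxG⟩
    obtain ⟨q, hq0, hqN, p, hp⟩ := exists_simultaneous_approx x hN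
    have hball := mem_closedBall_ratPoint hq0 hp
    have hq' : (0 : ℝ) < q := by exact_mod_cast hq0
    have hp' : ∀ i, -1 ≤ p i ∧ p i ≤ q + 1 := by
      intro i
      obtain ⟨h0, h1⟩ := hx i (mem_univ i)
      have h2 := abs_le.1 ((hp i).trans hN1)
      have h3 : q * x i ≤ q := mul_le_of_le_one_right hq'.le h1
      have h4 : 0 ≤ q * x i := by positivity
      constructor
      · have : (-1 : ℝ) ≤ p i := by linarith
        exact_mod_cast this
      · have : (p i : ℝ) ≤ q + 1 := by linarith
        exact_mod_cast this
    by_cases hqL : q ≤ L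
    · refine mem_biUnion (x := q) (by simp; omega) (mem_biUnion (x := p) ?_ hball)
      simpa only [SetLike.mem_coe, Fintype.mem_piFinset, Finset.mem_Icc] using hp'
    · refine absurd (mem_biUnion (x := (p, q)) ?_ hball) hxG
      simp only [approxIndex, SetLike.mem_coe, Finset.mem_product, Fintype.mem_piFinset,
        Finset.mem_Icc, Finset.mem_Ioc]
      refine ⟨fun i => ⟨(hp' i).1, (hp' i).2.trans ?_⟩, by omega, hqN⟩
      exact_mod_cast Nat.succ_le_succ hqN
  refine (measure_mono hsub).trans ((measure_biUnion_finset_le _ _).trans ?_)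
  have hterm : ∀ q ∈ Finset.Icc 1 L,
      volume (⋃ p ∈ Fintype.piFinset fun _ : Fin n => Finset.Icc (-1) (q + 1 : ℤ),
        closedBall (ratPoint p q) (1 / (q * N))) ≤ ENNReal.ofReal ((8 / N) ^ n) := by
    intro q hq
    have hq1 : (1 : ℝ) ≤ q := by exact_mod_cast (Finset.mem_Icc.1 hq).1
    refine (measure_biUnion_finset_le _ _).trans ?_
    have hv : ∀ p : Fin n → ℤ, volume (closedBall (ratPoint p q) (1 / (q * N))) =
        ENNReal.ofReal ((2 * (1 / (q * N))) ^ n) := fun p => by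
      rw [Real.volume_pi_closedBall _ (by positivity), Fintype.card_fin]
    have hcard : (q + 1 + 1 - -1 : ℤ).toNat = q + 3 := by omega
    simp only [hv, Finset.sum_const, nsmul_eq_mul, Fintype.card_piFinset, Int.card_Icc,
      Finset.prod_const, Finset.card_univ, Fintype.card_fin, hcard]
    rw [← ENNReal.ofReal_natCast, ← ENNReal.ofReal_mul (by positivity)]
    refine ENNReal.ofReal_le_ofReal ?_
    push_cast
    rw [← mul_pow]
    gcongr
    rw [← mul_assoc, mul_one_div, div_le_div_iff₀ (by positivity) (by positivity)]
    nlinarith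
  refine (Finset.sum_le_sum hterm).trans (le_of_eq ?_)
  rw [Finset.sum_const, Nat.card_Icc, Nat.add_sub_cancel, nsmul_eq_mul,
    ENNReal.ofReal_mul (by positivity), ENNReal.ofReal_natCast]

end BadSet

section Boxes

open Metric Topology ENNReal NNReal

/-- The uniform probability measure on the box `Icc lo hi`. -/
noncomputable def boxMeasure {n : ℕ} (lo hi : Fin n → ℝ) : Measure (Fin n → ℝ) :=
  (volume (Icc lo hi))⁻¹ • volume.restrict (Icc lo hi)

variable {n : ℕ} {lo hi : Fin n → ℝ}

theorem volume_Icc_ne_zero (h : ∀ i, lo i < hi i) : volume (Icc lo hi) ≠ 0 := by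
  rw [Real.volume_Icc_pi, Finset.prod_ne_zero_iff]
  intro i _
  simpa using h i

theorem boxMeasure_univ (h : ∀ i, lo i < hi i) : boxMeasure lo hi univ = 1 := by
  rw [boxMeasure, Measure.smul_apply, Measure.restrict_apply_univ, smul_eq_mul]
  exact ENNReal.inv_mul_cancel (volume_Icc_ne_zero h) isCompact_Icc.measure_lt_top.ne

theorem boxMeasure_compl : boxMeasure lo hi (Icc lo hi)ᶜ = 0 := by
  rw [boxMeasure, Measure.smul_apply, Measure.restrict_apply measurableSet_Icc.compl,
    compl_inter_self, measure_empty, smul_zero]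

theorem boxMeasure_le (h : ∀ i, lo i < hi i) :
    boxMeasure lo hi ≤ (volume (Icc lo hi))⁻¹.toNNReal • volume := by
  intro A
  rw [boxMeasure, Measure.smul_apply, Measure.smul_apply, ENNReal.smul_def,
    ENNReal.coe_toNNReal (ENNReal.inv_ne_top.2 (volume_Icc_ne_zero h))]
  exact mul_le_mul_right (Measure.restrict_le_self A) _

theorem boxMeasure_closedBall_le (h : ∀ i, lo i < hi i) (y : Fin n → ℝ) {r : ℝ} (hr : 0 < r) :
    boxMeasure lo hi (closedBall y r) ≤
      ENNReal.ofReal (∏ i, min 1 (2 * r / (hi i - lo i))) := by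
  have hpos : ∀ i, 0 < hi i - lo i := fun i => sub_pos.2 (h i)
  rw [boxMeasure, Measure.smul_apply, Measure.restrict_apply measurableSet_closedBall, smul_eq_mul,
    ← ENNReal.div_eq_inv_mul]
  refine ENNReal.div_le_of_le_mul ?_
  rw [Real.volume_Icc_pi, ENNReal.ofReal_prod_of_nonneg fun i _ => by
      have := hpos i; positivity, ← Finset.prod_mul_distrib, closedBall_pi y hr.le,
    ← pi_univ_Icc, ← pi_inter_distrib, volume_pi_pi]
  refine Finset.prod_le_prod' fun i _ => ?_
  rw [← ENNReal.ofReal_mul (by have := hpos i; positivity), min_mul_of_nonneg _ _ (hpos i).le,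
    one_mul, div_mul_cancel₀ _ (hpos i).ne', ENNReal.ofReal_min, ← Real.volume_Icc,
    ← Real.volume_closedBall (y i) r]
  exact le_min (measure_mono inter_subset_right) (measure_mono inter_subset_left)

end Boxes

section AnnulusBoxes

open Metric Topology ENNReal NNReal

/-- The union of the open annuli with radii `q ^ (-b) - q ^ (-a)` and `q ^ (-b)` around the rational
points with denominator `q > Q`. -/
def annuli (n : ℕ) (a b : ℝ) (Q : ℕ) : Set (Fin n → ℝ) :=
  {x | ∃ (p : Fin n → ℤ) (q : ℕ), Q < q ∧
    (q : ℝ) ^ (-b) - (q : ℝ) ^ (-a) < ‖x - ratPoint p q‖ ∧ ‖x - ratPoint p q‖ < (q : ℝ) ^ (-b)}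

theorem isOpen_annuli (n : ℕ) (a b : ℝ) (Q : ℕ) : IsOpen (annuli n a b Q) := by
  simp only [annuli, ofPred_exists]
  refine isOpen_iUnion fun p => isOpen_iUnion fun q => ?_
  refine isOpen_const.and ((isOpen_lt ?_ ?_).and (isOpen_lt ?_ ?_)) <;> fun_prop

/-- Lower corner of a box contained in the annulus around `p / q`. -/
noncomputable def boxLo {m : ℕ} (a b : ℝ) (p : Fin (m + 1) → ℤ) (q : ℕ) : Fin (m + 1) → ℝ :=
  Fin.cons (p 0 / q + (q : ℝ) ^ (-b) - 3 / 4 * (q : ℝ) ^ (-a))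
    fun i => p i.succ / q - (q : ℝ) ^ (-b) / 2

/-- Upper corner of a box contained in the annulus around `p / q`. -/
noncomputable def boxHi {m : ℕ} (a b : ℝ) (p : Fin (m + 1) → ℤ) (q : ℕ) : Fin (m + 1) → ℝ :=
  Fin.cons (p 0 / q + (q : ℝ) ^ (-b) - 1 / 4 * (q : ℝ) ^ (-a))
    fun i => p i.succ / q + (q : ℝ) ^ (-b) / 2

variable {m : ℕ} {a b : ℝ} {q : ℕ}

theorem boxLo_lt_boxHi (p : Fin (m + 1) → ℤ) (hq : 0 < q) (i : Fin (m + 1)) :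
    boxLo a b p q i < boxHi a b p q i := by
  have ha : 0 < (q : ℝ) ^ (-a) := Real.rpow_pos_of_pos (by exact_mod_cast hq) _
  have hb : 0 < (q : ℝ) ^ (-b) := Real.rpow_pos_of_pos (by exact_mod_cast hq) _
  refine Fin.cases ?_ (fun j => ?_) i
  · simp only [boxLo, boxHi, Fin.cons_zero]
    linarith
  · simp only [boxLo, boxHi, Fin.cons_succ]
    linarith

theorem norm_sub_ratPoint_of_mem_box (hab : b ≤ a) (hq : 0 < q) {p : Fin (m + 1) → ℤ}
    {x : Fin (m + 1) → ℝ} (hx : x ∈ Icc (boxLo a b p q) (boxHi a b p q)) :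
    (q : ℝ) ^ (-b) - (q : ℝ) ^ (-a) < ‖x - ratPoint p q‖ ∧
      ‖x - ratPoint p q‖ < (q : ℝ) ^ (-b) := by
  have ha : 0 < (q : ℝ) ^ (-a) := Real.rpow_pos_of_pos (by exact_mod_cast hq) _
  have hb : 0 < (q : ℝ) ^ (-b) := Real.rpow_pos_of_pos (by exact_mod_cast hq) _
  have hle : (q : ℝ) ^ (-a) ≤ (q : ℝ) ^ (-b) :=
    Real.rpow_le_rpow_of_exponent_le (by exact_mod_cast hq) (neg_le_neg hab)
  have h0 := And.intro (hx.1 0) (hx.2 0)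
  simp only [boxLo, boxHi, Fin.cons_zero] at h0
  constructor
  · refine lt_of_lt_of_le ?_ ((le_abs_self _).trans (norm_le_pi_norm (x - ratPoint p q) 0))
    rw [Pi.sub_apply, ratPoint]
    linarith
  · rw [pi_norm_lt_iff hb]
    intro i
    rw [Pi.sub_apply, ratPoint, Real.norm_eq_abs, abs_lt]
    refine Fin.cases ?_ (fun j => ?_) i
    · constructor <;> linarith
    · have h1 := And.intro (hx.1 j.succ) (hx.2 j.succ)
      simp only [boxLo, boxHi, Fin.cons_succ] at h1
      constructor <;> linarith

theorem boxMeasure_annulus_closedBall_le {s : ℝ} (hs : a * s = m + 2 + m * (a - b))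
    (hms : m ≤ s) (hsm : s ≤ m + 1) (p : Fin (m + 1) → ℤ) (hq : 0 < q) (y : Fin (m + 1) → ℝ)
    {r : ℝ} (hr : 0 < r) :
    boxMeasure (boxLo a b p q) (boxHi a b p q) (closedBall y r) ≤
      ENNReal.ofReal (4 ^ (m + 1) * q ^ (m + 2) * r ^ s) := by
  refine (boxMeasure_closedBall_le (boxLo_lt_boxHi p hq) y hr).trans
    (ENNReal.ofReal_le_ofReal ?_)
  have hq' : (0 : ℝ) < q := by exact_mod_cast hq
  have e0 : 2 * r / (boxHi a b p q 0 - boxLo a b p q 0) = 4 * r * (q : ℝ) ^ a := by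
    have := (Real.rpow_pos_of_pos hq' a).ne'
    simp only [boxLo, boxHi, Fin.cons_zero]
    rw [Real.rpow_neg hq'.le a, div_eq_iff (by ring_nf; positivity)]
    field_simp
    ring
  have e1 : ∀ i : Fin m, 2 * r / (boxHi a b p q i.succ - boxLo a b p q i.succ) =
      2 * r * (q : ℝ) ^ b := by
    intro i
    have := (Real.rpow_pos_of_pos hq' b).ne'
    simp only [boxLo, boxHi, Fin.cons_succ]
    rw [Real.rpow_neg hq'.le b, div_eq_iff (by ring_nf; positivity)]
    field_simp
    ring
  have h0 : min 1 (4 * r * (q : ℝ) ^ a) ≤ 4 * (r ^ (s - m) * (q : ℝ) ^ (a * (s - m))) := by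
    have hu : 0 < 4 * r * (q : ℝ) ^ a := by positivity
    have h1 : min 1 (4 * r * (q : ℝ) ^ a) ≤ (4 * r * (q : ℝ) ^ a) ^ (s - m) := by
      rcases le_total 1 (4 * r * (q : ℝ) ^ a) with h | h
      · exact (min_le_left _ _).trans (Real.one_le_rpow h (sub_nonneg.2 hms))
      · refine (min_le_right _ _).trans ?_
        exact Real.self_le_rpow_of_le_one hu.le h (by linarith)
    refine h1.trans ?_
    rw [Real.mul_rpow (by positivity) (by positivity), Real.mul_rpow (by positivity) hr.le,
      ← Real.rpow_mul hq'.le, mul_assoc]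
    gcongr
    calc (4 : ℝ) ^ (s - m) ≤ 4 ^ (1 : ℝ) :=
          Real.rpow_le_rpow_of_exponent_le (by norm_num) (by linarith)
      _ = 4 := Real.rpow_one 4
  rw [Fin.prod_univ_succ, e0]
  simp only [e1]
  rw [Finset.prod_const, Finset.card_univ, Fintype.card_fin]
  calc min 1 (4 * r * (q : ℝ) ^ a) * min 1 (2 * r * (q : ℝ) ^ b) ^ m
      ≤ (4 * (r ^ (s - m) * (q : ℝ) ^ (a * (s - m)))) * (4 * r * (q : ℝ) ^ b) ^ m := by
        gcongr
        refine (min_le_right _ _).trans ?_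
        gcongr
        norm_num
    _ = 4 ^ (m + 1) * ((q : ℝ) ^ (a * (s - m)) * ((q : ℝ) ^ b) ^ m) * (r ^ (s - m) * r ^ m) := by
        rw [mul_pow, mul_pow]
        ring
    _ = 4 ^ (m + 1) * q ^ (m + 2) * r ^ s := by
        rw [← Real.rpow_natCast r, ← Real.rpow_add hr, sub_add_cancel, ← Real.rpow_natCast _ m,
          ← Real.rpow_mul hq'.le, ← Real.rpow_add hq', ← Real.rpow_natCast _ (m + 2)]
        congr 3
        push_cast
        linarith

end AnnulusBoxes

section Step

open Metric Topology ENNReal NNReal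

/-- The displacement at scale `N` tends to `0` from above. -/
theorem tendsto_div_natCast_pow {K : ℝ} (hK : 0 < K) {n : ℕ} (hn : n ≠ 0) :
    Tendsto (fun N : ℕ => K / (N : ℝ) ^ n) atTop (𝓝[>] 0) := by
  refine tendsto_nhdsWithin_iff.2 ⟨?_, ?_⟩
  · exact tendsto_const_nhds.div_atTop ((tendsto_pow_atTop hn).comp tendsto_natCast_atTop_atTop)
  · filter_upwards [eventually_gt_atTop 0] with N hN
    have : (0 : ℝ) < N := by exact_mod_cast hN
    exact mem_Ioi.2 (by positivity)

theorem rpow_neg_le_of_mul_pow_lt {m q N : ℕ} {b c : ℝ} (hc : 0 < c) (hc1 : c ≤ 1) (hN : 0 < N)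
    (hb : 1 + 1 / ((m : ℝ) + 1) ≤ b) (hq : 0 < q) (hcq : c * (N : ℝ) ^ (m + 1) < q) :
    (q : ℝ) ^ (-b) ≤ (c ^ 2)⁻¹ / (N : ℝ) ^ (m + 2) := by
  have hN' : (0 : ℝ) < N := by exact_mod_cast hN
  have hm : (0 : ℝ) < m + 1 := by positivity
  set e : ℝ := 1 + 1 / ((m : ℝ) + 1) with he
  have he0 : 0 < e := by positivity
  have he2 : e ≤ 2 := by
    have : 1 / ((m : ℝ) + 1) ≤ 1 := by
      rw [div_le_one hm]
      linarith [(Nat.cast_nonneg m : (0 : ℝ) ≤ m)]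
    linarith
  calc (q : ℝ) ^ (-b) ≤ (q : ℝ) ^ (-e) :=
        Real.rpow_le_rpow_of_exponent_le (by exact_mod_cast hq) (neg_le_neg hb)
    _ ≤ (c * (N : ℝ) ^ (m + 1)) ^ (-e) :=
        Real.rpow_le_rpow_of_nonpos (by positivity) hcq.le (by linarith)
    _ = c ^ (-e) * ((N : ℝ) ^ (m + 2))⁻¹ := by
        rw [Real.mul_rpow hc.le (by positivity), ← Real.rpow_natCast _ (m + 1),
          ← Real.rpow_mul hN'.le, ← Real.rpow_natCast _ (m + 2), ← Real.rpow_neg hN'.le]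
        congr 2
        push_cast
        rw [he]
        field_simp
        ring
    _ ≤ c ^ (-2 : ℝ) * ((N : ℝ) ^ (m + 2))⁻¹ := by
        have := Real.rpow_le_rpow_of_exponent_ge hc hc1 (neg_le_neg he2)
        gcongr
    _ = (c ^ 2)⁻¹ / (N : ℝ) ^ (m + 2) := by
        rw [Real.rpow_neg hc.le, Real.rpow_two, div_eq_mul_inv]

/-- One step of the construction: a measure of bounded density on the unit cube can be moved
slightly into the annuli with large denominators, almost without loss of mass or regularity. -/
theorem exists_redistribution_into_annuli {m : ℕ} {a b s t : ℝ} (hab : b ≤ a)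
    (hb : 1 + 1 / ((m : ℝ) + 1) ≤ b) (hs : a * s = m + 2 + m * (a - b)) (hms : m ≤ s)
    (hsm : s ≤ m + 1) (ht : 0 ≤ t) (hts : t < s) {μ : Measure (Fin (m + 1) → ℝ)}
    {S : Set (Fin (m + 1) → ℝ)} (hSc : IsCompact S) (hSu : S ⊆ unitCube (m + 1)) (hS : μ Sᶜ = 0)
    {M : ℝ≥0} (hM : μ ≤ M • volume) {H H' : ℝ} (hH : 1 ≤ H) (hHH' : H < H')
    (hμ : ∀ x r, 0 < r → μ (closedBall x r) ≤ ENNReal.ofReal (H * r ^ t)) {c₀ : ℝ≥0∞}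
    (hc₀ : c₀ < μ univ) {ε : ℝ} (hε : 0 < ε) (Q₀ : ℕ) :
    ∃ (μ' : Measure (Fin (m + 1) → ℝ)) (S' : Set (Fin (m + 1) → ℝ)), IsCompact S' ∧ μ' S'ᶜ = 0 ∧
      S' ⊆ cthickening ε S ∧ S' ⊆ annuli (m + 1) a b Q₀ ∧ (∃ M' : ℝ≥0, μ' ≤ M' • volume) ∧
      (∀ x r, 0 < r → μ' (closedBall x r) ≤ ENNReal.ofReal (H' * r ^ t)) ∧ c₀ < μ' univ := by
  have hfin : IsFiniteMeasure μ := by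
    refine ⟨?_⟩
    rw [← union_compl_self S]
    refine (measure_union_le _ _).trans_lt ?_
    rw [hS, add_zero]
    refine (hM S).trans_lt ?_
    rw [Measure.smul_apply]
    exact ENNReal.mul_lt_top ENNReal.coe_lt_top hSc.measure_lt_top
  obtain ⟨c, ⟨hc0, hc1⟩, hcM⟩ : ∃ c : ℝ, (0 < c ∧ c ≤ 1) ∧
      c₀ + ENNReal.ofReal (M * (c * 8 ^ (m + 1))) < μ univ := by
    have h : Tendsto (fun c : ℝ => c₀ + ENNReal.ofReal (M * (c * 8 ^ (m + 1)))) (𝓝[>] 0)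
        (𝓝 (c₀ + ENNReal.ofReal (M * (0 * 8 ^ (m + 1))))) := by
      refine Tendsto.mono_left ?_ nhdsWithin_le_nhds
      exact tendsto_const_nhds.add
        ((ENNReal.continuous_ofReal.comp (by fun_prop)).tendsto (0 : ℝ))
    simp only [zero_mul, mul_zero, ENNReal.ofReal_zero, add_zero] at h
    have h1 : ∀ᶠ c : ℝ in 𝓝[>] 0, 0 < c ∧ c ≤ 1 := Ioc_mem_nhdsGT one_pos
    exact (h1.and (h.eventually_lt_const hc₀)).exists
  set K : ℝ := 2 * (c ^ 2)⁻¹ with hK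
  have hK0 : 0 < K := by positivity
  set C : ℝ := 4 ^ (m + 1) * K ^ (m + 1) with hC
  have hρlim := tendsto_div_natCast_pow hK0 (n := m + 2) (by omega)
  have hcN : Tendsto (fun N : ℕ => c * (N : ℝ) ^ (m + 1)) atTop atTop :=
    ((tendsto_pow_atTop (by omega)).comp tendsto_natCast_atTop_atTop).const_mul_atTop hc0
  obtain ⟨N, hgrow, hρε, hN, hQ₀⟩ := ((hρlim.eventually
    (eventually_redistribution_growth_le (C := C) hM hH hHH' ht hts
      (by push_cast; exact hsm) (by positivity) hμ)).and
    (((tendsto_nhdsWithin_iff.1 hρlim).1.eventually_le_const hε).and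
      ((eventually_gt_atTop 0).and (hcN.eventually_ge_atTop (Q₀ : ℝ))))).exists
  set ρ : ℝ := K / (N : ℝ) ^ (m + 2) with hρ
  have hN' : (0 : ℝ) < N := by exact_mod_cast hN
  set L : ℕ := ⌊c * (N : ℝ) ^ (m + 1)⌋₊ with hL
  set I := approxIndex (m + 1) L N with hI
  have hIq : ∀ i ∈ I, 0 < i.2 ∧ Q₀ < i.2 ∧ c * (N : ℝ) ^ (m + 1) < i.2 ∧ i.2 ≤ N ^ (m + 1) := by
    intro i hi
    obtain ⟨hLi, hiN⟩ := Finset.mem_Ioc.1 (Finset.mem_product.1 hi).2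
    exact ⟨by omega, (Nat.le_floor hQ₀).trans_lt hLi, Nat.lt_of_floor_lt hLi, hiN⟩
  obtain ⟨μ', S', hS'c, hμS', hS'R, hS'S, hM', hmass, hball⟩ := exists_redistribution μ volume hS I
    (fun i => closedBall (ratPoint i.1 i.2) (1 / (i.2 * N)))
    (fun i => Icc (boxLo a b i.1 i.2) (boxHi a b i.1 i.2))
    (fun i => boxMeasure (boxLo a b i.1 i.2) (boxHi a b i.1 i.2))
    (fun i => measurableSet_closedBall) (fun i => isCompact_Icc)
    (fun i hi => boxMeasure_univ (boxLo_lt_boxHi i.1 (hIq i hi).1))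
    (fun i hi => boxMeasure_compl) _
    (fun i hi => boxMeasure_le (boxLo_lt_boxHi i.1 (hIq i hi).1)) (ρ := ρ) (by
      intro i hi x hx y hy
      obtain ⟨hi0, -, hic, -⟩ := hIq i hi
      have hq' : (0 : ℝ) < i.2 := by exact_mod_cast hi0
      have h1 : dist x (ratPoint i.1 i.2) ≤ (c ^ 2)⁻¹ / (N : ℝ) ^ (m + 2) := by
        refine (mem_closedBall.1 hx).trans ?_
        rw [div_le_div_iff₀ (by positivity) (by positivity), one_mul,
          inv_mul_eq_div, le_div_iff₀ (by positivity)]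
        calc (N : ℝ) ^ (m + 2) * c ^ 2 = (c * N ^ (m + 1)) * N * c := by ring
          _ ≤ i.2 * N * 1 := by gcongr
          _ = i.2 * N := mul_one _
      have h2 : dist y (ratPoint i.1 i.2) ≤ (c ^ 2)⁻¹ / (N : ℝ) ^ (m + 2) := by
        rw [dist_eq_norm]
        exact (norm_sub_ratPoint_of_mem_box hab hi0 hy).2.le.trans
          (rpow_neg_le_of_mul_pow_lt hc0 hc1 hN hb hi0 hic)
      have h3 := dist_triangle_right y x (ratPoint i.1 i.2)
      have h4 : ρ = (c ^ 2)⁻¹ / (N : ℝ) ^ (m + 2) + (c ^ 2)⁻¹ / (N : ℝ) ^ (m + 2) := by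
        rw [hρ, hK]
        ring
      linarith)
  refine ⟨μ', S', hS'c, hμS', hS'S.trans (cthickening_mono hρε S), ?_, hM', ?_, ?_⟩
  · refine hS'R.trans (iUnion₂_subset fun i hi x hx => ?_)
    obtain ⟨hi0, hiQ, -, -⟩ := hIq i hi
    exact ⟨i.1, i.2, hiQ, norm_sub_ratPoint_of_mem_box hab hi0 hx⟩
  · intro x r hr
    refine (hball x r _ fun i hi => ?_).trans (hgrow x r hr)
    obtain ⟨hi0, -, -, hiN⟩ := hIq i hi
    refine le_min ?_ ?_
    · rw [← boxMeasure_univ (boxLo_lt_boxHi (a := a) (b := b) i.1 hi0)]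
      exact measure_mono (subset_univ _)
    · refine (boxMeasure_annulus_closedBall_le hs hms hsm i.1 hi0 x hr).trans
        (ENNReal.ofReal_le_ofReal ?_)
      have e : C * (ρ ^ (m + 1))⁻¹ = 4 ^ (m + 1) * ((N : ℝ) ^ (m + 1)) ^ (m + 2) := by
        rw [hC, hρ, div_pow, inv_div, ← pow_mul, ← pow_mul, mul_comm (m + 2)]
        field_simp
      rw [e]
      gcongr
      exact_mod_cast hiN
  · refine lt_of_lt_of_le ?_ hmass
    set G := ⋃ i ∈ I, closedBall (ratPoint i.1 i.2) (1 / (i.2 * N)) with hG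
    have hbad : μ Gᶜ ≤ ENNReal.ofReal (M * (c * 8 ^ (m + 1))) := calc
      μ Gᶜ = μ (Gᶜ ∩ S) := (measure_inter_conull hS).symm
      _ ≤ μ (unitCube (m + 1) \ G) := measure_mono fun x hx => ⟨hSu hx.2, hx.1⟩
      _ ≤ M * volume (unitCube (m + 1) \ G) := hM _
      _ ≤ M * ENNReal.ofReal (L * (8 / N) ^ (m + 1)) := by
          gcongr
          exact volume_unitCube_diff_le (m + 1) L hN
      _ ≤ ENNReal.ofReal (M * (c * 8 ^ (m + 1))) := by
          rw [← ENNReal.ofReal_coe_nnreal, ← ENNReal.ofReal_mul M.coe_nonneg]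
          refine ENNReal.ofReal_le_ofReal ?_
          gcongr _ * ?_
          calc (L : ℝ) * (8 / N) ^ (m + 1) ≤ c * N ^ (m + 1) * (8 / N) ^ (m + 1) := by
                gcongr
                exact Nat.floor_le (by positivity)
            _ = c * 8 ^ (m + 1) := by
                rw [div_pow]
                field_simp
    have h : c₀ + ENNReal.ofReal (M * (c * 8 ^ (m + 1))) <
        μ G + ENNReal.ofReal (M * (c * 8 ^ (m + 1))) := by
      refine hcM.trans_le ?_
      rw [← union_compl_self G]
      exact (measure_union_le _ _).trans (by gcongr)
    exact lt_of_add_lt_add_right h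

end Step

section LowerBound

open Metric Topology ENNReal NNReal

theorem exists_seq_of_forall_exists_succ {α : Type*} {P : ℕ → α → Prop} {R : ℕ → α → α → Prop}
    (h0 : ∃ x, P 0 x) (hstep : ∀ k x, P k x → ∃ y, P (k + 1) y ∧ R k x y) :
    ∃ f : ℕ → α, ∀ k, P k (f k) ∧ R k (f k) (f (k + 1)) := by
  choose g hg using hstep
  obtain ⟨x₀, hx₀⟩ := h0
  let F : (k : ℕ) → {x // P k x} := fun k =>
    Nat.rec ⟨x₀, hx₀⟩ (fun k x => ⟨g k x.1 x.2, (hg k x.1 x.2).1⟩) k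
  exact ⟨fun k => (F k).1, fun k => ⟨(F k).2, (hg k (F k).1 (F k).2).2⟩⟩

/-- Lebesgue measure on a subset of the unit cube has growth exponent `t ≤ n`. -/
theorem volume_restrict_inter_closedBall_le {n : ℕ} {t : ℝ} (ht : 0 ≤ t) (htn : t ≤ n)
    {S : Set (Fin n → ℝ)} (hS : S ⊆ unitCube n) (x : Fin n → ℝ) {r : ℝ} (hr : 0 < r) :
    volume.restrict S (closedBall x r) ≤ ENNReal.ofReal (2 ^ n * r ^ t) := by
  rcases le_total r 1 with h | h
  · refine (Measure.restrict_apply_le _ _).trans ?_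
    rw [Real.volume_pi_closedBall x hr.le, Fintype.card_fin]
    refine ENNReal.ofReal_le_ofReal ?_
    rw [mul_pow]
    gcongr
    rw [← Real.rpow_natCast]
    exact Real.rpow_le_rpow_of_exponent_ge hr h htn
  · calc volume.restrict S (closedBall x r) ≤ volume (unitCube n) := by
          refine (measure_mono (subset_univ _)).trans ?_
          rw [Measure.restrict_apply_univ]
          exact measure_mono hS
      _ = 1 := by simp only [unitCube, volume_pi_pi]; simp
      _ ≤ ENNReal.ofReal (2 ^ n * r ^ t) := by
          rw [← ENNReal.ofReal_one]
          exact ENNReal.ofReal_le_ofReal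
            (one_le_mul_of_one_le_of_one_le (one_le_pow₀ one_le_two) (Real.one_le_rpow h ht))

theorem hausdorffMeasure_annuli_ne_zero {m : ℕ} {a b s t : ℝ} (hab : b ≤ a)
    (hb : 1 + 1 / ((m : ℝ) + 1) ≤ b) (hs : a * s = m + 2 + m * (a - b)) (hms : m ≤ s)
    (hsm : s ≤ m + 1) (ht : 0 < t) (hts : t < s) :
    μH[t] {x ∈ unitCube (m + 1) | ∀ k, x ∈ annuli (m + 1) a b k} ≠ 0 := by
  let H : ℕ → ℝ := fun k => 2 ^ (m + 1) + 1 - 1 / ((k : ℝ) + 1)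
  have hH1 : ∀ k, 1 ≤ H k := fun k => by
    have h1 : 1 / ((k : ℝ) + 1) ≤ 1 := by
      rw [div_le_one (by positivity)]
      linarith [(Nat.cast_nonneg k : (0 : ℝ) ≤ k)]
    have h2 : (1 : ℝ) ≤ 2 ^ (m + 1) := one_le_pow₀ one_le_two
    simp only [H]
    linarith
  have hHlt : ∀ k, H k < H (k + 1) := fun k => by
    have : 1 / (((k + 1 : ℕ) : ℝ) + 1) < 1 / ((k : ℝ) + 1) := by
      push_cast
      gcongr
      linarith
    simp only [H]
    linarith
  set S₀ : Set (Fin (m + 1) → ℝ) := Icc (fun _ => 1 / 3) (fun _ => 2 / 3) with hS₀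
  have hS₀u : S₀ ⊆ interior (unitCube (m + 1)) := by
    rw [unitCube, interior_pi_set finite_univ]
    intro x hx i _
    rw [interior_Icc]
    have h1 := hx.1 i
    have h2 := hx.2 i
    simp only at h1 h2
    constructor <;> linarith
  have hvol : 0 < volume S₀ := by
    rw [hS₀, Real.volume_Icc_pi]
    refine pos_iff_ne_zero.2 (Finset.prod_ne_zero_iff.2 fun i _ => ?_)
    exact (ENNReal.ofReal_pos.2 (by norm_num)).ne'
  obtain ⟨c, hc0, hc⟩ := exists_between hvol
  obtain ⟨f, hf⟩ := exists_seq_of_forall_exists_succ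
    (α := Measure (Fin (m + 1) → ℝ) × Set (Fin (m + 1) → ℝ) × Set (Fin (m + 1) → ℝ))
    (P := fun k σ => IsCompact σ.2.2 ∧ σ.2.2 ⊆ unitCube (m + 1) ∧ IsCompact σ.2.1 ∧
      σ.2.1 ⊆ interior σ.2.2 ∧ σ.1 σ.2.1ᶜ = 0 ∧ (∃ M : ℝ≥0, σ.1 ≤ M • volume) ∧
      (∀ x r, 0 < r → σ.1 (closedBall x r) ≤ ENNReal.ofReal (H k * r ^ t)) ∧ c < σ.1 univ)
    (R := fun k σ σ' => σ'.2.2 ⊆ σ.2.2 ∩ annuli (m + 1) a b k)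
    ⟨⟨volume.restrict S₀, S₀, unitCube (m + 1)⟩, isCompact_univ_pi fun _ => isCompact_Icc,
      Subset.rfl, isCompact_Icc, hS₀u, by
        rw [Measure.restrict_apply measurableSet_Icc.compl, compl_inter_self, measure_empty],
      ⟨1, by rw [one_smul]; exact Measure.restrict_le_self⟩, fun x r hr => by
        have := volume_restrict_inter_closedBall_le ht.le (n := m + 1)
          (by push_cast; linarith) (hS₀u.trans interior_subset) x hr
        simpa [H] using this, by simpa using hc⟩
    (by
      rintro k ⟨μ, S, K⟩ ⟨hK, hKu, hS, hSK, hμS, ⟨M, hM⟩, hball, hmass⟩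
      dsimp only at *
      obtain ⟨ε, hε, hεK⟩ := hS.exists_cthickening_subset_open isOpen_interior hSK
      obtain ⟨μ', S', hS', hμS', hS'ε, hS'a, hM', hball', hmass'⟩ :=
        exists_redistribution_into_annuli hab hb hs hms hsm ht.le hts hS
          ((hSK.trans interior_subset).trans hKu) hμS hM (hH1 k) (hHlt k) hball hmass hε k
      obtain ⟨K', hK', hSK', hKK'⟩ := exists_compact_between hS'
        (isOpen_interior.inter (isOpen_annuli (m + 1) a b k))
        (subset_inter (hS'ε.trans hεK) hS'a)
      have hsub : K' ⊆ K ∩ annuli (m + 1) a b k :=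
        hKK'.trans (inter_subset_inter_left _ interior_subset)
      exact ⟨⟨μ', S', K'⟩, ⟨hK', fun x hx => hKu (hsub hx).1, hS', hSK', hμS', hM', hball', hmass'⟩,
        hsub⟩)
  have hne := hausdorffMeasure_iInter_ne_zero (K := fun k => (f k).2.2) (fun k => (hf k).1.1)
    (antitone_nat_of_succ_le fun k => fun x hx => ((hf k).2 hx).1) (fun k => (f k).1) (c := c)
    (C := ENNReal.ofReal (2 ^ (m + 1) + 1)) ht hc0.ne' ENNReal.ofReal_ne_top
    (by
      intro k
      obtain ⟨-, -, -, hSK, hμS, -, -, hmass⟩ := (hf k).1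
      refine hmass.le.trans ?_
      rw [← union_compl_self (f k).2.1]
      refine (measure_union_le _ _).trans ?_
      rw [hμS, add_zero]
      exact measure_mono (hSK.trans interior_subset))
    (by
      intro k x r hr
      refine ((hf k).1.2.2.2.2.2.2.1 x r hr).trans ?_
      rw [← ENNReal.ofReal_mul (by positivity)]
      refine ENNReal.ofReal_le_ofReal (mul_le_mul_of_nonneg_right ?_ (by positivity))
      have : 0 ≤ 1 / ((k : ℝ) + 1) := by positivity
      simp only [H]
      linarith)
  refine fun h => hne (measure_mono_null (fun x hx => ?_) h)
  have hx' := mem_iInter.1 hx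
  exact ⟨(hf 0).1.2.1 (hx' 0), fun k => ((hf k).2 (hx' (k + 1))).2⟩

theorem rpow_neg_div_self {q : ℝ} (hq : 0 < q) (τ : ℝ) : q ^ (-τ) / q = q ^ (-(1 + τ)) := by
  rw [← Real.rpow_sub_one hq.ne']
  congr 1
  ring

theorem one_sub_rpow_mul_rpow_div {q : ℝ} (hq : 0 < q) (τ τ' : ℝ) :
    (1 - q ^ (-τ')) * (q ^ (-τ) / q) = q ^ (-(1 + τ)) - q ^ (-(1 + τ + τ')) := by
  rw [rpow_neg_div_self hq, sub_mul, one_mul, ← Real.rpow_add hq]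
  congr 2
  ring

theorem annuli_subset_Wpsiphi (n : ℕ) (τ τ' : ℝ) :
    {x ∈ unitCube n | ∀ k, x ∈ annuli n (1 + τ + τ') (1 + τ) k} ⊆
      Wpsiphi n (fun q => (q : ℝ) ^ (-τ)) (fun q => (q : ℝ) ^ (-τ')) := by
  rintro x ⟨hx, h⟩
  refine ⟨hx, Set.Infinite.of_image Prod.snd (infinite_of_forall_exists_gt fun k => ?_)⟩
  obtain ⟨p, q, hq, h1, h2⟩ := h k
  have hq' : (0 : ℝ) < q := by exact_mod_cast (Nat.zero_le k).trans_lt hq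
  rw [← one_sub_rpow_mul_rpow_div hq'] at h1
  rw [← rpow_neg_div_self hq'] at h2
  exact ⟨q, ⟨(p, q), ⟨(Nat.zero_le k).trans_lt hq, h1, h2⟩, rfl⟩, hq⟩

theorem le_dimH_Wpsiphi {m : ℕ} {τ τ' s : ℝ} (hτ' : 0 ≤ τ') (hτ : 1 / ((m : ℝ) + 1) ≤ τ)
    (hs : (1 + τ + τ') * s = m + 2 + m * τ') (hms : m ≤ s) (hsm : s ≤ m + 1) :
    ENNReal.ofReal s ≤
      dimH (Wpsiphi (m + 1) (fun q => (q : ℝ) ^ (-τ)) (fun q => (q : ℝ) ^ (-τ'))) := by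
  refine le_of_forall_lt fun d hd => ?_
  lift d to ℝ≥0 using hd.ne_top
  rw [ENNReal.lt_ofReal_iff_toReal_lt ENNReal.coe_ne_top, ENNReal.coe_toReal] at hd
  obtain ⟨t, hdt, hts⟩ := exists_between hd
  have ht : 0 < t := d.coe_nonneg.trans_lt hdt
  have hne := hausdorffMeasure_annuli_ne_zero (m := m) (a := 1 + τ + τ') (b := 1 + τ) (s := s)
    (by linarith) (by linarith) (by rw [hs]; ring) hms hsm ht hts
  lift t to ℝ≥0 using ht.le
  refine lt_of_lt_of_le (by exact_mod_cast hdt)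
    ((le_dimH_of_hausdorffMeasure_ne_zero hne).trans (dimH_mono (annuli_subset_Wpsiphi _ _ _)))

end LowerBound

section UpperBound

open Metric Topology ENNReal NNReal

/-- Indices of the balls covering the annuli around the points `p / q` of the unit cube. -/
abbrev CoverIndex (m : ℕ) (K : ℕ → ℕ) : Type :=
  Σ q : ℕ, (Fin (m + 1) → Fin (q + 1)) × Fin (m + 1) × Bool × (Fin m → Fin (K q))

/-- Centers of the balls covering the annuli. -/
noncomputable def coverCenter {m : ℕ} (a b : ℝ) {K : ℕ → ℕ} (j : CoverIndex m K) :
    Fin (m + 1) → ℝ :=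
  j.2.2.1.insertNth
    ((j.2.1 j.2.2.1 : ℕ) / (j.1 : ℝ) + bif j.2.2.2.1 then (j.1 : ℝ) ^ (-b) else -(j.1 : ℝ) ^ (-b))
    fun i => (j.2.1 (j.2.2.1.succAbove i) : ℕ) / (j.1 : ℝ) - (j.1 : ℝ) ^ (-b) +
      (j.2.2.2.2 i : ℕ) * (j.1 : ℝ) ^ (-a)

theorem num_nonneg_and_le {n : ℕ} {b : ℝ} {q : ℕ} (hq : 0 < q) (hb : 1 ≤ b) {x : Fin n → ℝ}
    (hx : x ∈ unitCube n) {p : Fin n → ℤ} (h : ‖x - ratPoint p q‖ < (q : ℝ) ^ (-b)) (i : Fin n) :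
    0 ≤ p i ∧ p i ≤ q := by
  have hq' : (0 : ℝ) < q := by exact_mod_cast hq
  have hqu : (q : ℝ) * (q : ℝ) ^ (-b) ≤ 1 := by
    rw [mul_comm, ← Real.rpow_add_one hq'.ne']
    exact Real.rpow_le_one_of_one_le_of_nonpos (by exact_mod_cast hq) (by linarith)
  obtain ⟨h0, h1⟩ := hx i (mem_univ i)
  have h2 : |x i - p i / q| < (q : ℝ) ^ (-b) := (norm_le_pi_norm _ i).trans_lt h
  have h3 : |q * x i - p i| < 1 := by
    have e : q * x i - p i = q * (x i - p i / q) := by field_simp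
    rw [e, abs_mul, abs_of_pos hq']
    exact (mul_lt_mul_of_pos_left h2 hq').trans_le hqu
  have h4 := abs_lt.1 h3
  have h5 : q * x i ≤ q := mul_le_of_le_one_right hq'.le h1
  have h6 : 0 ≤ q * x i := by positivity
  constructor
  · have : (-1 : ℝ) < p i := by linarith
    have : (-1 : ℤ) < p i := by exact_mod_cast this
    omega
  · have : (p i : ℝ) < q + 1 := by linarith
    have : p i < (q : ℤ) + 1 := by exact_mod_cast this
    omega

theorem exists_mem_closedBall_coverCenter {m : ℕ} {a b : ℝ} {K : ℕ → ℕ} {q : ℕ} (hq : 0 < q)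
    (hb : 1 ≤ b) (hK : 2 * (q : ℝ) ^ (a - b) ≤ K q) {x : Fin (m + 1) → ℝ}
    (hx : x ∈ unitCube (m + 1)) {p : Fin (m + 1) → ℤ}
    (h1 : (q : ℝ) ^ (-b) - (q : ℝ) ^ (-a) < ‖x - ratPoint p q‖)
    (h2 : ‖x - ratPoint p q‖ < (q : ℝ) ^ (-b)) :
    ∃ y, x ∈ closedBall (coverCenter a b (K := K) ⟨q, y⟩) ((q : ℝ) ^ (-a)) := by
  have hq' : (0 : ℝ) < q := by exact_mod_cast hq
  set w := (q : ℝ) ^ (-a) with hw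
  set u := (q : ℝ) ^ (-b) with hu
  have hw0 : 0 < w := Real.rpow_pos_of_pos hq' _
  have hu0 : 0 < u := Real.rpow_pos_of_pos hq' _
  have hquw : 2 * u ≤ K q * w := by
    have e : u = (q : ℝ) ^ (a - b) * w := by
      rw [hu, hw, ← Real.rpow_add hq']
      congr 1
      ring
    rw [e, ← mul_assoc]
    gcongr
  have hcoord : ∀ i, |x i - p i / q| < u := fun i => (norm_le_pi_norm _ i).trans_lt h2
  have hp := num_nonneg_and_le hq hb hx h2
  obtain ⟨i, hi⟩ : ∃ i, u - w < |x i - p i / q| := by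
    by_contra! hcon
    exact absurd h1 (not_lt.2 ((pi_norm_le_iff_of_nonempty _).2 hcon))
  have hk : ∀ l, ⌊(x l - p l / q + u) / w⌋₊ < K q := by
    intro l
    have h3 := abs_lt.1 (hcoord l)
    rw [Nat.floor_lt' (by
      intro h
      rw [h] at hquw
      simp at hquw
      linarith), div_lt_iff₀ hw0]
    linarith
  have hcast : ∀ l, (((p l).toNat : ℕ) : ℝ) = p l := fun l => by
    exact_mod_cast Int.toNat_of_nonneg (hp l).1
  refine ⟨⟨fun l => ⟨(p l).toNat, by have := hp l; omega⟩, i, decide (p i / q ≤ x i),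
    fun l => ⟨_, hk (i.succAbove l)⟩⟩, ?_⟩
  rw [mem_closedBall, dist_pi_le_iff hw0.le]
  refine i.succAboveCases ?_ fun l => ?_
  · simp only [coverCenter, Fin.insertNth_apply_same, hcast]
    have h3 := hcoord i
    rw [Real.dist_eq]
    by_cases hle : p i / q ≤ x i
    · rw [abs_of_nonneg (by linarith)] at hi h3
      simp only [hle, decide_true, cond_true]
      rw [abs_le]
      constructor <;> linarith
    · rw [abs_of_neg (by linarith)] at hi h3
      simp only [hle, decide_false, cond_false]
      rw [abs_le]
      constructor <;> linarith
  · simp only [coverCenter, Fin.insertNth_apply_succAbove, hcast]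
    set z := x (i.succAbove l) - p (i.succAbove l) / q + u with hz
    have hz0 : 0 ≤ z := by linarith [(abs_lt.1 (hcoord (i.succAbove l))).1]
    have h3 : ⌊z / w⌋₊ * w ≤ z := by
      rw [← le_div_iff₀ hw0]
      exact Nat.floor_le (by positivity)
    have h4 : z < (⌊z / w⌋₊ + 1) * w := by
      rw [← div_lt_iff₀ hw0]
      exact Nat.lt_floor_add_one _
    rw [Real.dist_eq, abs_le]
    constructor <;> linarith

theorem tsum_ediam_coverCenter_ne_top {m : ℕ} {a b d : ℝ} (hab : b ≤ a) (hd : 0 < d) (ha : 0 < a)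
    (had : m + 2 + m * (a - b) < a * d) :
    ∑' j : CoverIndex m fun q => ⌈2 * (q : ℝ) ^ (a - b)⌉₊,
      ediam (closedBall (coverCenter a b j) ((j.1 : ℝ) ^ (-a))) ^ d ≠ ∞ := by
  set B : ℝ := 2 ^ (m + 1) * ((m + 1) * (2 * 3 ^ m)) * 2 ^ d with hB
  have hsum : Summable fun q : ℕ => B * (q : ℝ) ^ (m + 1 + m * (a - b) - a * d) :=
    (Real.summable_nat_rpow.2 (by linarith)).mul_left B
  rw [ENNReal.tsum_sigma']
  refine ne_top_of_le_ne_top hsum.tsum_ofReal_ne_top (ENNReal.tsum_le_tsum fun q => ?_)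
  have hdiam : ∀ x : Fin (m + 1) → ℝ, ediam (closedBall x ((q : ℝ) ^ (-a))) ^ d ≤
      ENNReal.ofReal ((2 * (q : ℝ) ^ (-a)) ^ d) := by
    intro x
    have h : ediam (closedBall x ((q : ℝ) ^ (-a))) ≤ ENNReal.ofReal (2 * (q : ℝ) ^ (-a)) := by
      refine ediam_le fun y hy z hz => ?_
      rw [edist_dist]
      refine ENNReal.ofReal_le_ofReal ((dist_triangle_right y z x).trans ?_)
      linarith [mem_closedBall.1 hy, mem_closedBall.1 hz]
    rw [← ENNReal.ofReal_rpow_of_nonneg (by positivity) hd.le]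
    gcongr
  refine (ENNReal.tsum_le_tsum fun y => hdiam _).trans ?_
  rw [ENNReal.tsum_const, ENat.card_eq_coe_fintype_card]
  rcases Nat.eq_zero_or_pos q with rfl | hq
  · simp [Real.zero_rpow (neg_ne_zero.2 ha.ne'), Real.zero_rpow hd.ne']
  have hq' : (0 : ℝ) < q := by exact_mod_cast hq
  have hq1 : (1 : ℝ) ≤ q := by exact_mod_cast hq
  have hK : (⌈2 * (q : ℝ) ^ (a - b)⌉₊ : ℝ) ≤ 3 * (q : ℝ) ^ (a - b) := by
    have h1 := Nat.ceil_lt_add_one (a := 2 * (q : ℝ) ^ (a - b)) (by positivity)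
    have h2 := Real.one_le_rpow hq1 (sub_nonneg.2 hab)
    linarith
  simp only [Fintype.card_prod, Fintype.card_fun, Fintype.card_fin, Fintype.card_bool]
  rw [ENat.toENNReal_coe, ← ENNReal.ofReal_natCast, ← ENNReal.ofReal_mul (Nat.cast_nonneg _)]
  refine ENNReal.ofReal_le_ofReal ?_
  push_cast
  calc ((q : ℝ) + 1) ^ (m + 1) * ((m + 1) * (2 * (⌈2 * (q : ℝ) ^ (a - b)⌉₊ : ℝ) ^ m)) *
        (2 * (q : ℝ) ^ (-a)) ^ d
      ≤ (2 * q) ^ (m + 1) * ((m + 1) * (2 * (3 * (q : ℝ) ^ (a - b)) ^ m)) *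
        (2 * (q : ℝ) ^ (-a)) ^ d := by
        gcongr
        linarith
    _ = B * ((q : ℝ) ^ (m + 1) * ((q : ℝ) ^ (a - b)) ^ m * ((q : ℝ) ^ (-a)) ^ d) := by
        rw [Real.mul_rpow zero_le_two (by positivity), hB]
        ring
    _ = B * (q : ℝ) ^ (m + 1 + m * (a - b) - a * d) := by
        rw [← Real.rpow_natCast, ← Real.rpow_natCast, ← Real.rpow_mul hq'.le,
          ← Real.rpow_mul hq'.le, ← Real.rpow_add hq', ← Real.rpow_add hq']
        congr 2
        push_cast
        ring

theorem hausdorffMeasure_Wpsiphi_eq_zero {m : ℕ} {τ τ' d : ℝ} (hτ : 0 ≤ τ) (hτ' : 0 ≤ τ')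
    (hd : 0 < d) (hmd : m + 2 + m * τ' < (1 + τ + τ') * d) :
    μH[d] (Wpsiphi (m + 1) (fun q => (q : ℝ) ^ (-τ)) (fun q => (q : ℝ) ^ (-τ'))) = 0 := by
  set a := 1 + τ + τ' with ha
  set b := 1 + τ with hb
  have hab : a - b = τ' := by rw [ha, hb]; ring
  refine measure_mono_null (fun x hx => ?_) (hausdorffMeasure_setOf_infinite_eq_zero hd
    (fun j : CoverIndex m fun q => ⌈2 * (q : ℝ) ^ (a - b)⌉₊ =>
      closedBall (coverCenter a b j) ((j.1 : ℝ) ^ (-a)))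
    (tsum_ediam_coverCenter_ne_top (by linarith) hd (by linarith) (by rwa [hab])))
  obtain ⟨hx, hinf⟩ := hx
  refine Set.Infinite.of_image Sigma.fst (infinite_of_not_bddAbove fun ⟨Q, hQ⟩ => hinf ?_)
  refine ((Fintype.piFinset fun _ => Finset.Icc 0 (Q : ℤ)) ×ˢ Finset.Iic Q).finite_toSet.subset ?_
  rintro ⟨p, q⟩ ⟨hq, h1, h2⟩
  dsimp only at hq h1 h2
  have hq' : (0 : ℝ) < q := by exact_mod_cast hq
  rw [one_sub_rpow_mul_rpow_div hq'] at h1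
  rw [rpow_neg_div_self hq'] at h2
  obtain ⟨y, hy⟩ := exists_mem_closedBall_coverCenter (a := a) (b := b)
    (K := fun q => ⌈2 * (q : ℝ) ^ (a - b)⌉₊) hq (by linarith) (Nat.le_ceil _) hx h1 h2
  have hqQ : q ≤ Q := hQ ⟨⟨q, y⟩, hy, rfl⟩
  simp only [SetLike.mem_coe, Finset.mem_product, Fintype.mem_piFinset, Finset.mem_Icc,
    Finset.mem_Iic]
  refine ⟨fun i => ?_, hqQ⟩
  have := num_nonneg_and_le hq (by linarith) hx h2 i
  omega

theorem dimH_Wpsiphi_le {m : ℕ} {τ τ' s : ℝ} (hτ : 0 ≤ τ) (hτ' : 0 ≤ τ')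
    (hs : (1 + τ + τ') * s = m + 2 + m * τ') :
    dimH (Wpsiphi (m + 1) (fun q => (q : ℝ) ^ (-τ)) (fun q => (q : ℝ) ^ (-τ'))) ≤
      ENNReal.ofReal s := by
  refine dimH_le fun d hd => ?_
  by_contra! hsd
  rw [← ENNReal.ofReal_coe_nnreal] at hsd
  have hd0 : (0 : ℝ) < d := ENNReal.ofReal_pos.1 (hsd.bot_lt)
  have hsd' : s < d := (ENNReal.ofReal_lt_ofReal_iff hd0).1 hsd
  rw [hausdorffMeasure_Wpsiphi_eq_zero hτ hτ' hd0
    (by rw [← hs]; exact mul_lt_mul_of_pos_left hsd' (by linarith))] at hd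
  exact ENNReal.zero_ne_top hd

end UpperBound

theorem stmt11 (n : ℕ) (hn : 2 ≤ n) (τψ τφ : ℝ) (hτφ : 0 < τφ)
    (h1 : (1 : ℝ) / n ≤ τψ) (h2 : τψ ≤ 2 / ((n : ℝ) - 1)) :
    dimH (Wpsiphi n (fun q => (q : ℝ) ^ (-τψ)) (fun q => (q : ℝ) ^ (-τφ))) =
      ENNReal.ofReal (((n : ℝ) + 1 + ((n : ℝ) - 1) * τφ) / (1 + τψ + τφ)) := by
  obtain ⟨m, rfl⟩ : ∃ m, n = m + 1 := ⟨n - 1, by omega⟩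
  have hm : (1 : ℝ) ≤ m := by exact_mod_cast Nat.le_of_succ_le_succ hn
  push_cast at h1 h2 ⊢
  rw [add_sub_cancel_right] at h2 ⊢
  have hτψ : 0 ≤ τψ := le_trans (by positivity) h1
  have ha : 0 < 1 + τψ + τφ := by linarith
  set s := ((m : ℝ) + 1 + 1 + m * τφ) / (1 + τψ + τφ) with hs
  have has : (1 + τψ + τφ) * s = m + 2 + m * τφ := by
    rw [hs]
    field_simp
    ring
  refine le_antisymm (dimH_Wpsiphi_le hτψ hτφ.le has) (le_dimH_Wpsiphi hτφ.le h1 has ?_ ?_)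
  · rw [hs, le_div_iff₀ ha]
    rw [le_div_iff₀ (by linarith)] at h2
    linarith
  · rw [hs, div_le_iff₀ ha]
    rw [div_le_iff₀ (by linarith)] at h1
    nlinarith
end
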